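/- arXiv:0706.1101 — 4 statements merged into one kernel-verified Lean document; each statement's English description precedes it below -/
import Mathlib

section
/- Let F_n and F be Herglotz functions, with Herglotz representations given by constants a_n, a ∈ ℝ and finite nonzero positive Borel measures ν_n, ν on ℝ∞. Then F_n(z) → F(z) uniformly on compact subsets of ℂ⁺ if and only if a_n → a and ν_n → ν in the weak-* sense, i.e., ∫_{ℝ∞} f dν_n → ∫_{ℝ∞} f dν for every continuous function f on ℝ∞. -/
open Filter Topology MeasureTheory

/-- A Herglotz function: a holomorphic map of the upper half plane to itself. -/
def IsHerglotz (F : ℂ → ℂ) : Prop :=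
  DifferentiableOn ℂ F {z : ℂ | 0 < z.im} ∧ ∀ z : ℂ, 0 < z.im → 0 < (F z).im

noncomputable instance : MeasurableSpace (OnePoint ℝ) := borel _
instance : BorelSpace (OnePoint ℝ) := ⟨rfl⟩

/-- The kernel (1+tz)/(t-z) of the Herglotz representation, interpreted as z at t = ∞. -/
noncomputable def herglotzKernel (z : ℂ) : OnePoint ℝ → ℂ :=
  fun t => Option.elim t z (fun s : ℝ => (1 + s * z) / (s - z))

theorem ofReal_sub_ne_zero {z : ℂ} (hz : z.im ≠ 0) (s : ℝ) : (s : ℂ) - z ≠ 0 := fun h =>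
  hz (by simpa using congrArg Complex.im h)

theorem ofReal_add_I_ne_zero (s : ℝ) : (s : ℂ) + Complex.I ≠ 0 := fun h => by
  simpa using congrArg Complex.im h

/-- The continuous function `t ↦ 1 / (t + i)` on `ℝ ∪ {∞}`, vanishing at `∞`. -/
noncomputable def resolventNegI : C(OnePoint ℝ, ℂ) where
  toFun t := Option.elim t 0 (fun s : ℝ => ((s : ℂ) + Complex.I)⁻¹)
  continuous_toFun := by
    rw [OnePoint.continuous_iff]
    refine ⟨?_, ?_⟩
    · rw [Filter.coclosedCompact_eq_cocompact]
      change Tendsto (fun s : ℝ => ((s : ℂ) + Complex.I)⁻¹) (cocompact ℝ) (𝓝 0)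
      refine tendsto_inv₀_cobounded.comp ?_
      rw [← Metric.cobounded_eq_cocompact]
      refine tendsto_norm_atTop_iff_cobounded.1 ?_
      refine tendsto_atTop_mono (fun s => ?_) (tendsto_norm_cobounded_atTop (E := ℝ))
      simpa using Complex.abs_re_le_norm ((s : ℂ) + Complex.I)
    · change Continuous (fun s : ℝ => ((s : ℂ) + Complex.I)⁻¹)
      exact (by fun_prop : Continuous fun s : ℝ => (s : ℂ) + Complex.I).inv₀
        ofReal_add_I_ne_zero

@[simp]
theorem resolventNegI_infty : resolventNegI OnePoint.infty = 0 := rfl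

@[simp]
theorem resolventNegI_coe (s : ℝ) :
    resolventNegI (s : OnePoint ℝ) = ((s : ℂ) + Complex.I)⁻¹ := rfl

theorem one_sub_mul_resolventNegI_ne_zero {z : ℂ} (hz : z.im ≠ 0) (t : OnePoint ℝ) :
    1 - (Complex.I + z) * resolventNegI t ≠ 0 := by
  induction t with
  | infty => simp
  | coe s =>
    have h := ofReal_add_I_ne_zero s
    have : 1 - (Complex.I + z) * resolventNegI (s : OnePoint ℝ) = (s - z) / (s + Complex.I) := by
      rw [resolventNegI_coe]; field_simp; ring
    rw [this]
    exact div_ne_zero (ofReal_sub_ne_zero hz s) h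

/-- The family of functions `t ↦ 1 / (t - z)` on `ℝ ∪ {∞}`, vanishing at `∞`, depending
continuously on the nonreal parameter `z`. -/
noncomputable def resolventFamily : C({z : ℂ // z.im ≠ 0}, C(OnePoint ℝ, ℂ)) :=
  ContinuousMap.curry
    { toFun := fun p => resolventNegI p.2 / (1 - (Complex.I + p.1) * resolventNegI p.2)
      continuous_toFun := by
        refine Continuous.div (by fun_prop) (by fun_prop) fun p => ?_
        exact one_sub_mul_resolventNegI_ne_zero p.1.2 p.2 }

theorem resolventFamily_infty (z : {z : ℂ // z.im ≠ 0}) :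
    resolventFamily z OnePoint.infty = 0 := by
  simp [resolventFamily]

theorem resolventFamily_coe (z : {z : ℂ // z.im ≠ 0}) (s : ℝ) :
    resolventFamily z (s : OnePoint ℝ) = ((s : ℂ) - z)⁻¹ := by
  have h := ofReal_add_I_ne_zero s
  have h' := ofReal_sub_ne_zero z.2 s
  have : 1 - (Complex.I + z) * ((s : ℂ) + Complex.I)⁻¹ = (s - z) / (s + Complex.I) := by
    field_simp; ring
  simp only [resolventFamily, ContinuousMap.curry_apply, ContinuousMap.coe_mk, resolventNegI_coe,
    this]
  field_simp

theorem herglotzKernel_eq (z : {z : ℂ // z.im ≠ 0}) (t : OnePoint ℝ) :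
    herglotzKernel z t = z + (1 + (z : ℂ) ^ 2) * resolventFamily z t := by
  induction t with
  | infty => rw [resolventFamily_infty]; simp only [mul_zero, add_zero]; rfl
  | coe s =>
    rw [resolventFamily_coe]
    change (1 + s * (z : ℂ)) / (s - z) = _
    have h' := ofReal_sub_ne_zero z.2 s
    field_simp
    ring

/-- The Herglotz kernel as a continuous family of continuous functions. -/
noncomputable def herglotzKernelFamily (z : {z : ℂ // z.im ≠ 0}) : C(OnePoint ℝ, ℂ) :=
  (z : ℂ) • (1 : C(OnePoint ℝ, ℂ)) + (1 + (z : ℂ) ^ 2) • resolventFamily z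

theorem herglotzKernelFamily_apply (z : {z : ℂ // z.im ≠ 0}) (t : OnePoint ℝ) :
    herglotzKernelFamily z t = herglotzKernel z t := by
  simp [herglotzKernelFamily, herglotzKernel_eq]

theorem continuous_herglotzKernelFamily : Continuous herglotzKernelFamily := by
  unfold herglotzKernelFamily
  fun_prop

theorem resolventFamily_mul (z w : {z : ℂ // z.im ≠ 0}) (h : (z : ℂ) ≠ w) :
    resolventFamily z * resolventFamily w =
      ((z : ℂ) - w)⁻¹ • (resolventFamily z - resolventFamily w) := by
  ext t
  simp only [ContinuousMap.mul_apply, ContinuousMap.smul_apply, ContinuousMap.sub_apply,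
    smul_eq_mul]
  induction t with
  | infty => simp [resolventFamily_infty]
  | coe s =>
    rw [resolventFamily_coe, resolventFamily_coe]
    have h1 := ofReal_sub_ne_zero z.2 s
    have h2 := ofReal_sub_ne_zero w.2 s
    have h3 := sub_ne_zero.2 h
    field_simp
    ring

theorem star_resolventFamily (z : {z : ℂ // z.im ≠ 0}) :
    star (resolventFamily z) =
      resolventFamily ⟨(starRingEnd ℂ) z, by simpa using z.2⟩ := by
  ext t
  induction t with
  | infty => simp [resolventFamily_infty]
  | coe s => simp [resolventFamily_coe]

theorem exists_seq_nonreal_tendsto (z : {z : ℂ // z.im ≠ 0}) :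
    ∃ y : ℕ → {z : ℂ // z.im ≠ 0}, Tendsto y atTop (𝓝 z) ∧
      ∀ n, (y n : ℂ) ≠ z ∧ (y n : ℂ).im = (z : ℂ).im := by
  refine ⟨fun n => ⟨(z : ℂ) + ((1 / ((n : ℝ) + 1) : ℝ) : ℂ), by simpa using z.2⟩, ?_, ?_⟩
  · rw [tendsto_subtype_rng]
    have h1 : Tendsto (fun n : ℕ => ((1 / ((n : ℝ) + 1) : ℝ) : ℂ)) atTop (𝓝 ((0 : ℝ) : ℂ)) :=
      (Complex.continuous_ofReal.tendsto 0).comp tendsto_one_div_add_atTop_nhds_zero_nat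
    simpa using (tendsto_const_nhds (x := (z : ℂ))).add h1
  · refine fun n => ⟨fun h => ?_, by rw [Complex.add_im, Complex.ofReal_im, add_zero]⟩
    have h2 : ((1 / ((n : ℝ) + 1) : ℝ) : ℂ) = 0 := add_eq_left.1 h
    have h3 : (0 : ℝ) < 1 / ((n : ℝ) + 1) := by positivity
    exact h3.ne' (by exact_mod_cast h2)

theorem resolventFamily_mul_mem_closure (z w : {z : ℂ // z.im ≠ 0}) :
    resolventFamily z * resolventFamily w ∈
      (Submodule.span ℂ (insert 1 (Set.range resolventFamily))).topologicalClosure := by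
  have hmem (x) : resolventFamily x ∈ Submodule.span ℂ (insert 1 (Set.range resolventFamily)) :=
    Submodule.subset_span (Or.inr ⟨x, rfl⟩)
  by_cases h : (z : ℂ) = w
  · obtain rfl : z = w := Subtype.ext h
    obtain ⟨y, hy, hyz⟩ := exists_seq_nonreal_tendsto z
    have hlim : Tendsto (fun n => resolventFamily (y n) * resolventFamily z) atTop
        (𝓝 (resolventFamily z * resolventFamily z)) :=
      ((resolventFamily.continuous.tendsto z).comp hy).mul_const _
    refine mem_closure_of_tendsto hlim (Eventually.of_forall fun n => ?_)
    rw [resolventFamily_mul]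
    · exact Submodule.smul_mem _ _ (Submodule.sub_mem _ (hmem _) (hmem _))
    · exact (hyz n).1
  · rw [resolventFamily_mul z w h]
    exact Submodule.le_topologicalClosure _
      (Submodule.smul_mem _ _ (Submodule.sub_mem _ (hmem _) (hmem _)))

theorem resolventFamily_mul_mem_of_mem_closure (z : {z : ℂ // z.im ≠ 0}) (f : C(OnePoint ℝ, ℂ))
    (hf : f ∈ (Submodule.span ℂ (insert 1 (Set.range resolventFamily))).topologicalClosure) :
    resolventFamily z * f ∈
      (Submodule.span ℂ (insert 1 (Set.range resolventFamily))).topologicalClosure := by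
  set M := (Submodule.span ℂ (insert 1 (Set.range resolventFamily))).topologicalClosure
  have hcl : IsClosed (M : Set C(OnePoint ℝ, ℂ)) := Submodule.isClosed_topologicalClosure _
  suffices h : M ≤ M.comap (LinearMap.mulLeft ℂ (resolventFamily z)) from h hf
  refine Submodule.topologicalClosure_minimal _ (Submodule.span_le.2 ?_)
    (hcl.preimage (continuous_const_mul (resolventFamily z)))
  rintro _ (rfl | ⟨w, rfl⟩)
  · have h : resolventFamily z ∈ M :=
      Submodule.le_topologicalClosure _ (Submodule.subset_span (Or.inr ⟨z, rfl⟩))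
    simpa using h
  · exact resolventFamily_mul_mem_closure z w

/-- The resolvent functions together with the constants span a dense subspace of `C(ℝ ∪ {∞}, ℂ)`. -/
theorem span_resolventFamily_closure_eq_top :
    (Submodule.span ℂ (insert 1 (Set.range resolventFamily))).topologicalClosure = ⊤ := by
  set M := (Submodule.span ℂ (insert 1 (Set.range resolventFamily))).topologicalClosure with hM
  have hcl : IsClosed (M : Set C(OnePoint ℝ, ℂ)) := Submodule.isClosed_topologicalClosure _
  have hone : (1 : C(OnePoint ℝ, ℂ)) ∈ M :=
    Submodule.le_topologicalClosure _ (Submodule.subset_span (Or.inl rfl))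
  let A := StarAlgebra.adjoin ℂ (Set.range resolventFamily)
  have hAM : A.toSubalgebra.toSubmodule ≤ M := by
    rw [StarAlgebra.adjoin_toSubalgebra, Algebra.adjoin_eq_span, Submodule.span_le]
    have key : ∀ x ∈ Submonoid.closure (Set.range resolventFamily ∪ star (Set.range resolventFamily)),
        ∀ f ∈ M, x * f ∈ M := by
      intro x hx
      induction hx using Submonoid.closure_induction with
      | mem x hx =>
        rcases hx with ⟨z, rfl⟩ | ⟨z, hz⟩
        · exact resolventFamily_mul_mem_of_mem_closure z
        · rw [← star_star x, ← hz, star_resolventFamily]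
          exact resolventFamily_mul_mem_of_mem_closure _
      | one => intro f hf; simpa using hf
      | mul x y _ _ hx hy => intro f hf; rw [mul_assoc]; exact hx _ (hy _ hf)
    intro x hx
    simpa using key x hx 1 hone
  have hsep : A.SeparatesPoints := by
    intro s t hst
    let i : {z : ℂ // z.im ≠ 0} := ⟨Complex.I, by simp⟩
    refine ⟨resolventFamily i, ⟨resolventFamily i, StarAlgebra.subset_adjoin ℂ _ ⟨i, rfl⟩, rfl⟩, ?_⟩
    induction s with
    | infty =>
      induction t with
      | infty => exact absurd rfl hst
      | coe t =>
        rw [resolventFamily_infty, resolventFamily_coe]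
        exact (inv_ne_zero (ofReal_sub_ne_zero i.2 t)).symm
    | coe s =>
      induction t with
      | infty =>
        rw [resolventFamily_infty, resolventFamily_coe]
        exact inv_ne_zero (ofReal_sub_ne_zero i.2 s)
      | coe t =>
        rw [resolventFamily_coe, resolventFamily_coe]
        intro h
        have h' := sub_left_injective (inv_injective h)
        exact hst (by rw [Complex.ofReal_injective h'])
  have htop := ContinuousMap.starSubalgebra_topologicalClosure_eq_top_of_separatesPoints A hsep
  rw [eq_top_iff]
  intro f _
  have hf : f ∈ A.topologicalClosure := htop ▸ StarSubalgebra.mem_top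
  exact closure_minimal hAM hcl hf

section Integration

variable {X : Type*} [TopologicalSpace X] [CompactSpace X] [MeasurableSpace X] [BorelSpace X]

theorem ContinuousMap.integrable_of_isFiniteMeasure (μ : Measure X) [IsFiniteMeasure μ]
    (f : C(X, ℂ)) : Integrable f μ :=
  f.continuous.integrable_of_hasCompactSupport (HasCompactSupport.of_compactSpace f)

theorem ContinuousMap.norm_integral_sub_le (μ : Measure X) [IsFiniteMeasure μ] (f g : C(X, ℂ)) :
    ‖(∫ t, f t ∂μ) - ∫ t, g t ∂μ‖ ≤ μ.real Set.univ * dist f g := by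
  rw [← integral_sub (f.integrable_of_isFiniteMeasure μ) (g.integrable_of_isFiniteMeasure μ),
    mul_comm]
  refine norm_integral_le_of_norm_le_const (Eventually.of_forall fun t => ?_)
  rw [← dist_eq_norm]
  exact ContinuousMap.dist_apply_le_dist t

theorem uniformEquicontinuous_add_integral {ν : ℕ → Measure X} (hfin : ∀ n, IsFiniteMeasure (ν n))
    (a : ℕ → ℂ) {m : ℝ} (hν : Tendsto (fun n => (ν n).real Set.univ) atTop (𝓝 m)) :
    UniformEquicontinuous (fun n (f : C(X, ℂ)) => a n + ∫ t, f t ∂(ν n)) := by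
  obtain ⟨C, hC⟩ := hν.bddAbove_range
  refine LipschitzWith.uniformEquicontinuous _ C.toNNReal fun n => ?_
  refine LipschitzWith.of_dist_le_mul fun f g => ?_
  rw [dist_add_left, dist_eq_norm]
  refine (f.norm_integral_sub_le (ν n) g).trans ?_
  gcongr
  exact (hC ⟨n, rfl⟩).trans (Real.le_coe_toNNReal C)

theorem tendsto_integral_of_mem_closure_span {ν : ℕ → Measure X} {μ : Measure X}
    (hfin : ∀ n, IsFiniteMeasure (ν n)) [IsFiniteMeasure μ]
    (hν : Tendsto (fun n => (ν n).real Set.univ) atTop (𝓝 (μ.real Set.univ)))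
    {S : Set C(X, ℂ)}
    (hS : ∀ f ∈ S, Tendsto (fun n => ∫ t, f t ∂(ν n)) atTop (𝓝 (∫ t, f t ∂μ)))
    (f : C(X, ℂ)) (hf : f ∈ (Submodule.span ℂ S).topologicalClosure) :
    Tendsto (fun n => ∫ t, f t ∂(ν n)) atTop (𝓝 (∫ t, f t ∂μ)) := by
  have hequi : Equicontinuous (fun n (f : C(X, ℂ)) => ∫ t, f t ∂(ν n)) := by
    simpa using (uniformEquicontinuous_add_integral hfin 0 hν).equicontinuous
  have hcont : Continuous (fun f : C(X, ℂ) => ∫ t, f t ∂μ) := by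
    refine (LipschitzWith.of_dist_le_mul (K := (μ.real Set.univ).toNNReal) fun f g => ?_).continuous
    rw [dist_eq_norm, Real.coe_toNNReal _ measureReal_nonneg]
    exact f.norm_integral_sub_le μ g
  refine closure_minimal (s := (Submodule.span ℂ S : Set C(X, ℂ))) ?_
    (hequi.isClosed_setOfPred_tendsto hcont) hf
  intro g hg
  change Tendsto (fun n => ∫ t, g t ∂(ν n)) atTop (𝓝 (∫ t, g t ∂μ))
  induction hg using Submodule.span_induction with
  | mem g hg => exact hS g hg
  | zero => simp
  | add g h _ _ hg hh =>
    have (ρ : Measure X) [IsFiniteMeasure ρ] :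
        ∫ t, (g + h) t ∂ρ = (∫ t, g t ∂ρ) + ∫ t, h t ∂ρ :=
      integral_add (g.integrable_of_isFiniteMeasure ρ) (h.integrable_of_isFiniteMeasure ρ)
    simpa only [this] using hg.add hh
  | smul c g _ hg =>
    have (ρ : Measure X) : ∫ t, (c • g) t ∂ρ = c * ∫ t, g t ∂ρ := integral_const_mul c g
    simpa only [this] using hg.const_mul c

theorem tendsto_integral_complex_of_real {ν : ℕ → Measure X} {μ : Measure X}
    (hfin : ∀ n, IsFiniteMeasure (ν n)) [IsFiniteMeasure μ]
    (h : ∀ f : C(X, ℝ), Tendsto (fun n => ∫ t, f t ∂(ν n)) atTop (𝓝 (∫ t, f t ∂μ)))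
    (f : C(X, ℂ)) : Tendsto (fun n => ∫ t, f t ∂(ν n)) atTop (𝓝 (∫ t, f t ∂μ)) := by
  have key (ρ : Measure X) [IsFiniteMeasure ρ] : ∫ t, f t ∂ρ =
      ((∫ t, (f t).re ∂ρ : ℝ) : ℂ) + ((∫ t, (f t).im ∂ρ : ℝ) : ℂ) * Complex.I :=
    (integral_re_add_im (f.integrable_of_isFiniteMeasure ρ)).symm
  simp only [key]
  have hre := h ⟨fun t => (f t).re, by fun_prop⟩
  have him := h ⟨fun t => (f t).im, by fun_prop⟩
  exact ((Complex.continuous_ofReal.tendsto _).comp hre).add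
    (((Complex.continuous_ofReal.tendsto _).comp him).mul_const _)

end Integration

theorem integral_herglotzKernel_I (μ : Measure (OnePoint ℝ)) :
    ∫ t, herglotzKernel Complex.I t ∂μ = (μ.real Set.univ : ℂ) * Complex.I := by
  have h (t) : herglotzKernel Complex.I t = Complex.I := by
    rw [herglotzKernel_eq ⟨Complex.I, by simp⟩]; simp
  simp [h]

theorem stmt2 (F : ℕ → ℂ → ℂ) (Flim : ℂ → ℂ)
    (hF : ∀ n, IsHerglotz (F n)) (hFlim : IsHerglotz Flim)
    (a : ℕ → ℝ) (alim : ℝ)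
    (ν : ℕ → Measure (OnePoint ℝ)) (νlim : Measure (OnePoint ℝ))
    (hfin : ∀ n, IsFiniteMeasure (ν n)) (hfinl : IsFiniteMeasure νlim)
    (hne : ∀ n, ν n ≠ 0) (hnel : νlim ≠ 0)
    (hrep : ∀ n, ∀ z : ℂ, 0 < z.im → F n z = a n + ∫ t, herglotzKernel z t ∂(ν n))
    (hrepl : ∀ z : ℂ, 0 < z.im → Flim z = alim + ∫ t, herglotzKernel z t ∂νlim) :
    (∀ K : Set ℂ, K ⊆ {z : ℂ | 0 < z.im} → IsCompact K →
        TendstoUniformlyOn (fun n => F n) Flim atTop K) ↔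
      (Tendsto a atTop (𝓝 alim) ∧
        ∀ f : C(OnePoint ℝ, ℝ),
          Tendsto (fun n => ∫ t, f t ∂(ν n)) atTop (𝓝 (∫ t, f t ∂νlim))) := by
  have hker (ρ : Measure (OnePoint ℝ)) (z : {z : ℂ // z.im ≠ 0}) :
      ∫ t, herglotzKernelFamily z t ∂ρ = ∫ t, herglotzKernel z t ∂ρ := by
    simp only [herglotzKernelFamily_apply]
  constructor
  · intro h
    have hpt (z : ℂ) (hz : 0 < z.im) : Tendsto (fun n => F n z) atTop (𝓝 (Flim z)) :=
      (h {z} (by simpa using hz) isCompact_singleton).tendsto_at rfl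
    have hI := hpt Complex.I (by simp)
    simp only [hrep _ Complex.I (by simp), hrepl Complex.I (by simp),
      integral_herglotzKernel_I] at hI
    have ha : Tendsto a atTop (𝓝 alim) := by
      simpa [Function.comp_def] using (Complex.continuous_re.tendsto _).comp hI
    have hmass : Tendsto (fun n => (ν n).real Set.univ) atTop (𝓝 (νlim.real Set.univ)) := by
      simpa [Function.comp_def] using (Complex.continuous_im.tendsto _).comp hI
    refine ⟨ha, fun f => ?_⟩
    have haC : Tendsto (fun n => (a n : ℂ)) atTop (𝓝 (alim : ℂ)) :=
      (Complex.continuous_ofReal.tendsto _).comp ha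
    have hmassC : Tendsto (fun n => ((ν n).real Set.univ : ℂ)) atTop
        (𝓝 (νlim.real Set.univ : ℂ)) := (Complex.continuous_ofReal.tendsto _).comp hmass
    have hres_int (ρ : Measure (OnePoint ℝ)) [IsFiniteMeasure ρ] (z : {z : ℂ // z.im ≠ 0}) :
        ∫ t, herglotzKernel z t ∂ρ =
          z * (ρ.real Set.univ : ℂ) + (1 + (z : ℂ) ^ 2) * ∫ t, resolventFamily z t ∂ρ := by
      simp only [herglotzKernel_eq]
      rw [integral_add (integrable_const _)
        (((resolventFamily z).integrable_of_isFiniteMeasure ρ).const_mul _), integral_const_mul]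
      simp [mul_comm]
    have hgen (z : {z : ℂ // z.im ≠ 0}) (hz : 0 < (z : ℂ).im) (hzI : (z : ℂ) ≠ Complex.I) :
        Tendsto (fun n => ∫ t, resolventFamily z t ∂(ν n)) atTop
          (𝓝 (∫ t, resolventFamily z t ∂νlim)) := by
      have hsq : 1 + (z : ℂ) ^ 2 ≠ 0 := fun h0 => by
        have h1 : ((z : ℂ) - Complex.I) * ((z : ℂ) + Complex.I) = 0 := by
          linear_combination h0 - Complex.I_sq
        rcases mul_eq_zero.1 h1 with h2 | h2
        · exact hzI (sub_eq_zero.1 h2)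
        · have h3 := congrArg Complex.im h2
          simp only [Complex.add_im, Complex.I_im, Complex.zero_im] at h3
          linarith
      have hint (ρ : Measure (OnePoint ℝ)) [IsFiniteMeasure ρ] (c w : ℂ)
          (hw : w = c + ∫ t, herglotzKernel z t ∂ρ) :
          ∫ t, resolventFamily z t ∂ρ =
            (w - c - z * (ρ.real Set.univ : ℂ)) / (1 + (z : ℂ) ^ 2) := by
        rw [hw, hres_int ρ z]
        field_simp
        ring
      rw [hint νlim _ _ (hrepl z hz)]
      simp only [fun n => hint (ν n) _ _ (hrep n z hz)]
      exact (((hpt z hz).sub haC).sub (hmassC.const_mul _)).div_const _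
    have hupper (z : {z : ℂ // z.im ≠ 0}) (hz : 0 < (z : ℂ).im) :
        Tendsto (fun n => ∫ t, resolventFamily z t ∂(ν n)) atTop
          (𝓝 (∫ t, resolventFamily z t ∂νlim)) := by
      by_cases hzI : (z : ℂ) = Complex.I
      · obtain ⟨y, hy, hyz⟩ := exists_seq_nonreal_tendsto z
        refine tendsto_integral_of_mem_closure_span hfin hmass
          (S := Set.range fun n => resolventFamily (y n)) ?_ _ ?_
        · rintro _ ⟨n, rfl⟩
          exact hgen (y n) ((hyz n).2 ▸ hz) (hzI ▸ (hyz n).1)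
        · exact mem_closure_of_tendsto ((resolventFamily.continuous.tendsto z).comp hy)
            (Eventually.of_forall fun n => Submodule.subset_span ⟨n, rfl⟩)
      · exact hgen z hz hzI
    have hall (z : {z : ℂ // z.im ≠ 0}) :
        Tendsto (fun n => ∫ t, resolventFamily z t ∂(ν n)) atTop
          (𝓝 (∫ t, resolventFamily z t ∂νlim)) := by
      rcases z.2.lt_or_gt with hz | hz
      · have hconj (ρ : Measure (OnePoint ℝ)) : ∫ t, resolventFamily z t ∂ρ = (starRingEnd ℂ)
            (∫ t, resolventFamily ⟨(starRingEnd ℂ) z, by simpa using z.2⟩ t ∂ρ) := by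
          rw [← star_resolventFamily, ← integral_conj]
          simp
        simp only [hconj]
        exact (Complex.continuous_conj.tendsto _).comp (hupper _ (by simpa using hz))
      · exact hupper z hz
    have hcomplex := tendsto_integral_of_mem_closure_span hfin hmass
      (S := insert 1 (Set.range resolventFamily))
      (by
        rintro _ (rfl | ⟨z, rfl⟩)
        · simpa using hmassC
        · exact hall z)
      ⟨fun t => (f t : ℂ), by fun_prop⟩
      (by rw [span_resolventFamily_closure_eq_top]; trivial)
    simp only [ContinuousMap.coe_mk, integral_complex_ofReal] at hcomplex
    simpa [Function.comp_def] using (Complex.continuous_re.tendsto _).comp hcomplex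
  · rintro ⟨ha, hν⟩ K hK hKc
    have hνC := tendsto_integral_complex_of_real hfin hν
    have hmass : Tendsto (fun n => (ν n).real Set.univ) atTop (𝓝 (νlim.real Set.univ)) := by
      simpa using hν 1
    have haC : Tendsto (fun n => (a n : ℂ)) atTop (𝓝 (alim : ℂ)) :=
      (Complex.continuous_ofReal.tendsto _).comp ha
    let ι : K → {z : ℂ // z.im ≠ 0} := fun z => ⟨z, (hK z.2).ne'⟩
    have hι : Continuous ι := by fun_prop
    have hFn (n : ℕ) (z : K) : F n z = a n + ∫ t, herglotzKernelFamily (ι z) t ∂(ν n) := by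
      rw [hker, hrep n z (hK z.2)]
    have hFl (z : K) : Flim z = alim + ∫ t, herglotzKernelFamily (ι z) t ∂νlim := by
      rw [hker, hrepl z (hK z.2)]
    have hequi : Equicontinuous (fun n (z : K) => F n z) := by
      intro z U hU
      simp only [hFn]
      exact ((continuous_herglotzKernelFamily.comp hι).tendsto z).eventually
        ((uniformEquicontinuous_add_integral hfin (fun n => (a n : ℂ)) hmass).equicontinuous _ U hU)
    have : CompactSpace K := isCompact_iff_compactSpace.1 hKc
    rw [tendstoUniformlyOn_iff_tendstoUniformly_comp_coe]
    refine UniformFun.tendsto_iff_tendstoUniformly.1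
      ((hequi.tendsto_uniformFun_iff_pi atTop (fun z : K => Flim z)).2 ?_)
    rw [tendsto_pi_nhds]
    intro z
    simp only [hFn, hFl]
    exact haC.add (hνC _)
end

section
/- Let F_n and F be Herglotz functions with F_n → F uniformly on compact subsets of ℂ⁺. Then F_n → F in value distribution: for all Borel sets A, S ⊆ ℝ with |A| < ∞, ∫_A ω_{F_n(t)}(S) dt → ∫_A ω_{F(t)}(S) dt as n → ∞. -/
open Filter Topology MeasureTheory Complex

/-- Harmonic measure of a Borel set S ⊆ ℝ seen from z ∈ ℂ⁺:
ω_z(S) = (1/π) ∫_S Im z / ((t - Re z)² + (Im z)²) dt. -/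
noncomputable def harmMeas (z : ℂ) (S : Set ℝ) : ℝ :=
  (1 / Real.pi) * ∫ t in S, z.im / ((t - z.re) ^ 2 + z.im ^ 2)

open scoped symmDiff

lemma poissonKernel_eq_im (z : ℂ) (t : ℝ) :
    z.im / ((t - z.re) ^ 2 + z.im ^ 2) = (((t : ℂ) - z)⁻¹).im := by
  simp [Complex.inv_im, Complex.normSq_apply, sq]

lemma poissonKernel_eq_cauchyPDFReal {z : ℂ} (hz : 0 < z.im) (t : ℝ) :
    z.im / ((t - z.re) ^ 2 + z.im ^ 2) =
      Real.pi * ProbabilityTheory.cauchyPDFReal z.re z.im.toNNReal t := by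
  rw [ProbabilityTheory.cauchyPDFReal_def, Real.coe_toNNReal _ hz.le]
  field_simp

lemma integrable_poissonKernel {z : ℂ} (hz : 0 < z.im) :
    Integrable fun t : ℝ => z.im / ((t - z.re) ^ 2 + z.im ^ 2) := by
  simp_rw [poissonKernel_eq_cauchyPDFReal hz]
  exact (ProbabilityTheory.integrable_cauchyPDFReal _).const_mul _

lemma integral_poissonKernel {z : ℂ} (hz : 0 < z.im) :
    ∫ t : ℝ, z.im / ((t - z.re) ^ 2 + z.im ^ 2) = Real.pi := by
  simp_rw [poissonKernel_eq_cauchyPDFReal hz]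
  rw [integral_const_mul, ProbabilityTheory.integral_cauchyPDFReal_eq_one, mul_one]
  exact (Real.toNNReal_pos.2 hz).ne'

lemma poissonKernel_nonneg {z : ℂ} (hz : 0 < z.im) (t : ℝ) :
    0 ≤ z.im / ((t - z.re) ^ 2 + z.im ^ 2) := by positivity

lemma harmMeas_nonneg {z : ℂ} (hz : 0 < z.im) (S : Set ℝ) : 0 ≤ harmMeas z S :=
  mul_nonneg (by positivity) (integral_nonneg (poissonKernel_nonneg hz))

lemma harmMeas_le_one {z : ℂ} (hz : 0 < z.im) (S : Set ℝ) : harmMeas z S ≤ 1 := by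
  have h : ∫ t in S, z.im / ((t - z.re) ^ 2 + z.im ^ 2) ≤ Real.pi :=
    (setIntegral_le_integral (integrable_poissonKernel hz)
      (Eventually.of_forall (poissonKernel_nonneg hz))).trans_eq (integral_poissonKernel hz)
  rw [harmMeas, one_div, inv_mul_le_iff₀ Real.pi_pos, mul_one]
  exact h

lemma abs_harmMeas_le_one {z : ℂ} (hz : 0 < z.im) (S : Set ℝ) : |harmMeas z S| ≤ 1 := by
  rw [abs_of_nonneg (harmMeas_nonneg hz S)]
  exact harmMeas_le_one hz S

lemma poissonKernel_eq_div_norm_sq (z : ℂ) (t : ℝ) :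
    z.im / ((t - z.re) ^ 2 + z.im ^ 2) = z.im / ‖(t : ℂ) - z‖ ^ 2 := by
  rw [Complex.sq_norm, Complex.normSq_apply]
  simp [sq]

lemma poissonKernel_le_of_dist_lt {z w : ℂ} (hz : 0 < z.im) (hw : dist w z < z.im / 2) (t : ℝ) :
    w.im / ((t - w.re) ^ 2 + w.im ^ 2) ≤ 6 * (z.im / ((t - z.re) ^ 2 + z.im ^ 2)) := by
  rw [poissonKernel_eq_div_norm_sq, poissonKernel_eq_div_norm_sq]
  rw [dist_eq_norm] at hw
  have him : w.im ≤ 3 / 2 * z.im := by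
    have := (Complex.abs_im_le_norm (w - z)).trans hw.le
    rw [Complex.sub_im, abs_le] at this
    linarith
  have hzt : z.im ≤ ‖(t : ℂ) - z‖ := by
    have := Complex.abs_im_le_norm ((t : ℂ) - z)
    simp only [Complex.sub_im, Complex.ofReal_im, zero_sub, abs_neg, abs_of_pos hz] at this
    exact this
  have htri : ‖(t : ℂ) - z‖ ≤ ‖(t : ℂ) - w‖ + ‖w - z‖ := by
    simpa using norm_add_le ((t : ℂ) - w) (w - z)
  have hhalf : ‖(t : ℂ) - z‖ / 2 ≤ ‖(t : ℂ) - w‖ := by linarith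
  have hpos : 0 < ‖(t : ℂ) - z‖ := hz.trans_le hzt
  calc w.im / ‖(t : ℂ) - w‖ ^ 2 ≤ (3 / 2 * z.im) / (‖(t : ℂ) - z‖ / 2) ^ 2 := by gcongr
    _ = 6 * (z.im / ‖(t : ℂ) - z‖ ^ 2) := by field_simp; norm_num

lemma continuousAt_harmMeas {z : ℂ} (hz : 0 < z.im) (S : Set ℝ) :
    ContinuousAt (fun w => harmMeas w S) z := by
  have hball : ∀ᶠ w in 𝓝 z, dist w z < z.im / 2 := Metric.ball_mem_nhds z (half_pos hz)
  have hpos : ∀ᶠ w : ℂ in 𝓝 z, 0 < w.im :=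
    (isOpen_lt continuous_const Complex.continuous_im).mem_nhds hz
  refine continuousAt_const.mul (continuousAt_of_dominated
    (bound := fun t => 6 * (z.im / ((t - z.re) ^ 2 + z.im ^ 2))) ?_ ?_ ?_ ?_)
  · filter_upwards [hpos] with w hw
    exact (integrable_poissonKernel hw).aestronglyMeasurable.restrict
  · filter_upwards [hball, hpos] with w hw hw'
    refine Eventually.of_forall fun t => ?_
    rw [Real.norm_of_nonneg (poissonKernel_nonneg hw' t)]
    exact poissonKernel_le_of_dist_lt hz hw t
  · exact ((integrable_poissonKernel hz).const_mul 6).restrict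
  · refine Eventually.of_forall fun t => ?_
    have : (t - z.re) ^ 2 + z.im ^ 2 ≠ 0 := by positivity
    fun_prop (disch := exact this)

/-- Mean value property of harmonic measure along a holomorphic map of the unit disc to the upper
half plane. -/
lemma circleAverage_harmMeas {Ψ : ℂ → ℂ} (hΨ : DifferentiableOn ℂ Ψ (Metric.ball 0 1))
    (him : ∀ ζ ∈ Metric.ball (0 : ℂ) 1, 0 < (Ψ ζ).im) {r : ℝ} (hr0 : 0 ≤ r) (hr1 : r < 1)
    (S : Set ℝ) :
    Real.circleAverage (fun ζ => harmMeas (Ψ ζ) S) 0 r = harmMeas (Ψ 0) S := by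
  have hmem : ∀ θ : ℝ, circleMap 0 r θ ∈ Metric.ball (0 : ℂ) 1 := fun θ => by
    simpa [abs_of_nonneg hr0] using hr1
  have hcont : Continuous fun θ : ℝ => Ψ (circleMap 0 r θ) :=
    hΨ.continuousOn.comp_continuous (continuous_circleMap 0 r) hmem
  set k : ℝ → ℝ → ℝ := fun θ t => (Ψ (circleMap 0 r θ)).im /
    ((t - (Ψ (circleMap 0 r θ)).re) ^ 2 + (Ψ (circleMap 0 r θ)).im ^ 2) with hk
  have hk0 : ∀ θ t, 0 ≤ k θ t := fun θ t => poissonKernel_nonneg (him _ (hmem θ)) t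
  have hkc : Continuous (Function.uncurry k) := by
    simp only [hk, Function.uncurry_def]
    have h2 : Continuous fun p : ℝ × ℝ => Ψ (circleMap 0 r p.1) := hcont.comp continuous_fst
    have hre := Complex.continuous_re.comp h2
    have hIm := Complex.continuous_im.comp h2
    refine hIm.div (((continuous_snd.sub hre).pow 2).add (hIm.pow 2)) fun p => ?_
    have := him _ (hmem p.1)
    positivity
  have hmv : ∀ t : ℝ, ∫ θ in (0)..(2 * Real.pi), k θ t =
      2 * Real.pi * ((Ψ 0).im / ((t - (Ψ 0).re) ^ 2 + (Ψ 0).im ^ 2)) := fun t => by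
    have hne : ∀ ζ ∈ Metric.ball (0 : ℂ) 1, (t : ℂ) - Ψ ζ ≠ 0 := fun ζ hζ h => by
      have := congrArg Complex.im h
      simp [(him ζ hζ).ne'] at this
    have hd : DifferentiableOn ℂ (fun ζ => ((t : ℂ) - Ψ ζ)⁻¹) (Metric.ball 0 1) :=
      ((differentiableOn_const _).sub hΨ).inv hne
    have hdc : DiffContOnCl ℂ (fun ζ => ((t : ℂ) - Ψ ζ)⁻¹) (Metric.ball 0 |r|) := by
      refine (hd.mono ?_).diffContOnCl
      refine Metric.closure_ball_subset_closedBall.trans (Metric.closedBall_subset_ball ?_)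
      rwa [abs_of_nonneg hr0]
    have h := hdc.circleAverage
    rw [Real.circleAverage_def, inv_smul_eq_iff₀ (by positivity)] at h
    have hi : IntervalIntegrable (fun θ : ℝ => ((t : ℂ) - Ψ (circleMap 0 r θ))⁻¹) volume 0
        (2 * Real.pi) :=
      ((continuous_const.sub hcont).inv₀ fun θ => hne _ (hmem θ)).intervalIntegrable _ _
    have h3 := Complex.imCLM.intervalIntegral_comp_comm hi
    rw [h] at h3
    simp only [hk, poissonKernel_eq_im]
    simpa using h3
  have hint : Integrable (Function.uncurry k)
      ((volume.restrict (Set.uIoc 0 (2 * Real.pi))).prod (volume.restrict S)) := by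
    rw [integrable_prod_iff' hkc.aestronglyMeasurable]
    constructor
    · refine Eventually.of_forall fun t => ?_
      have : Continuous fun θ => Function.uncurry k (θ, t) := by fun_prop
      exact (this.intervalIntegrable _ _).def'
    · have : (fun t => ∫ θ in Set.uIoc 0 (2 * Real.pi), ‖Function.uncurry k (θ, t)‖) = fun t =>
          2 * Real.pi * ((Ψ 0).im / ((t - (Ψ 0).re) ^ 2 + (Ψ 0).im ^ 2)) := by
        ext t
        rw [← hmv t, intervalIntegral.integral_of_le (by positivity),
          Set.uIoc_of_le (by positivity)]
        simp only [Function.uncurry, Real.norm_of_nonneg (hk0 _ _)]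
      rw [this]
      exact ((integrable_poissonKernel (him 0 (by simp))).const_mul _).restrict
  have hswap := integral_integral_swap (f := k) hint
  rw [Real.circleAverage_def, inv_smul_eq_iff₀ (by positivity),
    intervalIntegral.integral_of_le (by positivity), smul_eq_mul]
  rw [Set.uIoc_of_le (by positivity)] at hswap
  simp only [← intervalIntegral.integral_of_le (show (0 : ℝ) ≤ 2 * Real.pi by positivity), hmv]
    at hswap
  rw [← intervalIntegral.integral_of_le (show (0 : ℝ) ≤ 2 * Real.pi by positivity)]
  simp only [harmMeas]
  rw [intervalIntegral.integral_const_mul, hswap, integral_const_mul]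
  ring

lemma circleMap_two_mul_arctan_add_pi (s : ℝ) :
    circleMap 0 1 (2 * Real.arctan s + Real.pi) = -(1 + s * I) ^ 2 / (1 + s ^ 2) := by
  have h0 : (0 : ℝ) < 1 + s ^ 2 := by positivity
  have hsq : ((Real.sqrt (1 + s ^ 2) : ℝ) : ℂ) ^ 2 = 1 + s ^ 2 := by
    rw [← Complex.ofReal_pow, Real.sq_sqrt h0.le]
    push_cast
    ring
  have hexp : cexp (Real.arctan s * I) = (1 + s * I) / (Real.sqrt (1 + s ^ 2) : ℝ) := by
    rw [Complex.exp_mul_I, ← Complex.ofReal_cos, ← Complex.ofReal_sin, Real.cos_arctan,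
      Real.sin_arctan]
    push_cast
    ring
  have hsplit : ((2 * Real.arctan s + Real.pi : ℝ) : ℂ) * I =
      Real.arctan s * I + Real.arctan s * I + Real.pi * I := by
    push_cast
    ring
  rw [circleMap, hsplit, Complex.exp_add, Complex.exp_add, Complex.exp_pi_mul_I, hexp, ← hsq]
  push_cast
  ring

lemma intervalIntegral_eq_integral_arctan (G : ℝ → ℝ) :
    ∫ θ in (0)..(2 * Real.pi), G θ =
      ∫ s : ℝ, 2 * (1 + s ^ 2)⁻¹ * G (2 * Real.arctan s + Real.pi) := by
  have himage : (fun s => 2 * Real.arctan s + Real.pi) '' Set.univ =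
      Set.Ioo 0 (2 * Real.pi) := by
    rw [Set.image_univ, show (fun s => 2 * Real.arctan s + Real.pi) =
      (fun u => 2 * u + Real.pi) ∘ Real.arctan from rfl, Set.range_comp, Real.range_arctan,
      Set.image_affine_Ioo (by norm_num)]
    congr 1 <;> ring
  rw [intervalIntegral.integral_of_le (by positivity), integral_Ioc_eq_integral_Ioo, ← himage,
    integral_image_eq_integral_abs_deriv_smul MeasurableSet.univ
      (f' := fun s => 2 * (1 + s ^ 2)⁻¹)
      (fun s _ => (((Real.hasDerivAt_arctan' s).const_mul 2).add_const _).hasDerivWithinAt)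
      (fun s _ t _ h => Real.arctan_injective (by simpa using h))]
  simp only [Measure.restrict_univ, smul_eq_mul]
  refine integral_congr_ae (Eventually.of_forall fun s => ?_)
  simp only
  rw [abs_of_pos (by positivity)]

lemma cayley_im_pos {ζ : ℂ} (hζ : ζ ∈ Metric.ball (0 : ℂ) 1) :
    0 < (I * (1 + ζ) / (1 - ζ)).im := by
  have hn : ‖ζ‖ < 1 := by simpa using hζ
  have hne : 1 - ζ ≠ 0 := fun h => by
    rw [← sub_eq_zero.1 h] at hn
    simp at hn
  have hsq : ζ.re * ζ.re + ζ.im * ζ.im < 1 := by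
    rw [← Complex.normSq_apply, Complex.normSq_eq_norm_sq]
    nlinarith [norm_nonneg ζ]
  have : (I * (1 + ζ) / (1 - ζ)).im =
      (1 - (ζ.re * ζ.re + ζ.im * ζ.im)) / Complex.normSq (1 - ζ) := by
    rw [Complex.div_im]
    simp
    ring
  rw [this]
  exact div_pos (by linarith) (Complex.normSq_pos.2 hne)

/-- Poisson formula for harmonic measure along a Herglotz function. -/
lemma IsHerglotz.integral_harmMeas {F : ℂ → ℂ} (hF : IsHerglotz F) (S : Set ℝ) (x : ℝ)
    {ε y : ℝ} (hε : 0 < ε) (hy : 0 < y) :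
    ∫ s : ℝ, (1 + s ^ 2)⁻¹ * harmMeas (F (((x + y * s : ℝ) : ℂ) + ε * I)) S =
      Real.pi * harmMeas (F (x + ((ε + y : ℝ) : ℂ) * I)) S := by
  set C : ℂ → ℂ := fun ζ => x + ε * I + y * (I * (1 + ζ) / (1 - ζ)) with hC
  have hopen : IsOpen {z : ℂ | 0 < z.im} := isOpen_lt continuous_const Complex.continuous_im
  have hCim : ∀ ζ ∈ Metric.ball (0 : ℂ) 1, 0 < (C ζ).im := fun ζ hζ => by
    have : (C ζ).im = ε + y * (I * (1 + ζ) / (1 - ζ)).im := by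
      simp only [hC, Complex.add_im, Complex.im_ofReal_mul]
      simp
    rw [this]
    have := cayley_im_pos hζ
    positivity
  have hCd : ∀ ζ : ℂ, 1 - ζ ≠ 0 → DifferentiableAt ℂ C ζ := fun ζ hζ => by
    simp only [hC]
    fun_prop (disch := exact hζ)
  have hne : ∀ ζ ∈ Metric.ball (0 : ℂ) 1, 1 - ζ ≠ 0 := fun ζ hζ h => by
    rw [← sub_eq_zero.1 h] at hζ
    simp at hζ
  have hΨd : DifferentiableOn ℂ (fun ζ => F (C ζ)) (Metric.ball 0 1) :=
    hF.1.comp (fun ζ hζ => (hCd ζ (hne ζ hζ)).differentiableWithinAt) hCim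
  have hΨim : ∀ ζ ∈ Metric.ball (0 : ℂ) 1, 0 < (F (C ζ)).im := fun ζ hζ => hF.2 _ (hCim ζ hζ)
  have hcontAt : ∀ ζ : ℂ, 1 - ζ ≠ 0 → 0 < (C ζ).im →
      ContinuousAt (fun ζ => harmMeas (F (C ζ)) S) ζ := fun ζ h1 h2 =>
    (continuousAt_harmMeas (hF.2 _ h2) S).comp
      (f := fun ζ => F (C ζ)) (ContinuousAt.comp
        ((hF.1.differentiableAt (hopen.mem_nhds h2)).continuousAt) (hCd ζ h1).continuousAt)
  have hcont : ContinuousOn (fun ζ => harmMeas (F (C ζ)) S) (Metric.ball 0 1) := fun ζ hζ =>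
    (hcontAt ζ (hne ζ hζ) (hCim ζ hζ)).continuousWithinAt
  have hmem : ∀ r ∈ Set.Ioo (0 : ℝ) 1, ∀ θ : ℝ, circleMap 0 r θ ∈ Metric.ball (0 : ℂ) 1 :=
    fun r hr θ => by simpa [abs_of_pos hr.1] using hr.2
  have hIoo : ∀ᶠ r in 𝓝[<] (1 : ℝ), r ∈ Set.Ioo (0 : ℝ) 1 := Ioo_mem_nhdsLT zero_lt_one
  have hC0 : C 0 = x + ((ε + y : ℝ) : ℂ) * I := by
    simp only [hC]
    push_cast
    ring
  have hconst : ∀ r ∈ Set.Ioo (0 : ℝ) 1, ∫ s : ℝ, 2 * (1 + s ^ 2)⁻¹ *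
      harmMeas (F (C (circleMap 0 r (2 * Real.arctan s + Real.pi)))) S =
      2 * Real.pi * harmMeas (F (C 0)) S := fun r hr => by
    have h := circleAverage_harmMeas hΨd hΨim hr.1.le hr.2 S
    rw [Real.circleAverage_def, inv_smul_eq_iff₀ (by positivity),
      intervalIntegral_eq_integral_arctan, smul_eq_mul] at h
    exact h
  have hlim : Tendsto (fun r : ℝ => ∫ s : ℝ, 2 * (1 + s ^ 2)⁻¹ *
      harmMeas (F (C (circleMap 0 r (2 * Real.arctan s + Real.pi)))) S) (𝓝[<] 1)
      (𝓝 (∫ s : ℝ, 2 * (1 + s ^ 2)⁻¹ *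
        harmMeas (F (((x + y * s : ℝ) : ℂ) + ε * I)) S)) := by
    refine tendsto_integral_filter_of_dominated_convergence (fun s => 2 * (1 + s ^ 2)⁻¹)
      ?_ ?_ (integrable_inv_one_add_sq.const_mul 2) ?_
    · filter_upwards [hIoo] with r hr
      have h1 : Continuous fun s : ℝ => circleMap 0 r (2 * Real.arctan s + Real.pi) :=
        (continuous_circleMap 0 r).comp (by fun_prop)
      have h2 : Continuous fun s : ℝ => (1 + s ^ 2)⁻¹ :=
        Continuous.inv₀ (by fun_prop) fun s => by positivity
      exact ((continuous_const.mul h2).mul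
        (hcont.comp_continuous h1 fun s => hmem r hr _)).aestronglyMeasurable
    · filter_upwards [hIoo] with r hr
      refine Eventually.of_forall fun s => ?_
      rw [norm_mul, Real.norm_of_nonneg (by positivity)]
      exact mul_le_of_le_one_right (by positivity) (abs_harmMeas_le_one (hΨim _ (hmem r hr _)) S)
    · refine Eventually.of_forall fun s => ?_
      set ζ := circleMap 0 1 (2 * Real.arctan s + Real.pi) with hζ
      have hs : (1 : ℂ) + s ^ 2 ≠ 0 := by
        have : (1 + s ^ 2 : ℝ) ≠ 0 := by positivity
        exact_mod_cast this
      have hs' : (1 : ℂ) + s * I ≠ 0 := fun h => by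
        have := congrArg Complex.re h
        simp at this
      have hsub : 1 - ζ = 2 * (1 + s * I) / (1 + s ^ 2) := by
        rw [hζ, circleMap_two_mul_arctan_add_pi, eq_div_iff hs, sub_mul, div_mul_cancel₀ _ hs]
        linear_combination (s : ℂ) ^ 2 * I_sq
      have hadd : I * (1 + ζ) = s * (2 * (1 + s * I) / (1 + s ^ 2)) := by
        rw [hζ, circleMap_two_mul_arctan_add_pi]
        field_simp
        linear_combination (-2 * (s : ℂ) - s ^ 2 * I) * I_sq
      have hne0 : 1 - ζ ≠ 0 := by
        rw [hsub]
        exact div_ne_zero (mul_ne_zero two_ne_zero hs') hs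
      have hCζ : C ζ = ((x + y * s : ℝ) : ℂ) + ε * I := by
        simp only [hC]
        rw [hadd, ← hsub, mul_div_cancel_right₀ _ hne0]
        push_cast
        ring
      have hpos : 0 < (C ζ).im := by
        rw [hCζ]
        simpa using hε
      refine Tendsto.const_mul _ ?_
      rw [← hCζ]
      refine (hcontAt ζ hne0 hpos).tendsto.comp
        (f := fun r : ℝ => circleMap 0 r (2 * Real.arctan s + Real.pi)) ?_
      have : Continuous fun r : ℝ => circleMap 0 r (2 * Real.arctan s + Real.pi) := by
        unfold circleMap
        fun_prop
      exact (this.tendsto 1).mono_left nhdsWithin_le_nhds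
  have huniq := tendsto_nhds_unique (hlim.congr' (hIoo.mono hconst)) tendsto_const_nhds
  rw [hC0] at huniq
  simp only [mul_assoc] at huniq
  rw [integral_const_mul] at huniq
  exact mul_left_cancel₀ two_ne_zero huniq

lemma measurable_measureReal_translate_symmDiff {A : Set ℝ} (hA : MeasurableSet A) :
    Measurable fun s : ℝ => volume.real (((fun t => t - s) ⁻¹' A) ∆ A) := by
  have hT : MeasurableSet
      (((fun p : ℝ × ℝ => p.2 - p.1) ⁻¹' A) ∆ ((fun p : ℝ × ℝ => p.2) ⁻¹' A)) :=
    ((measurable_snd.sub measurable_fst) hA).symmDiff (measurable_snd hA)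
  exact (measurable_measure_prodMk_left (ν := (volume : Measure ℝ)) hT).ennreal_toReal

lemma measure_translate_preimage (A : Set ℝ) (s : ℝ) :
    volume ((fun t => t - s) ⁻¹' A) = volume A := by
  simp [sub_eq_add_neg]

lemma measureReal_translate_symmDiff_le {A : Set ℝ} (hA : volume A < ⊤) (s : ℝ) :
    volume.real (((fun t => t - s) ⁻¹' A) ∆ A) ≤ 2 * volume.real A := by
  have h : volume (((fun t => t - s) ⁻¹' A) ∆ A) ≤ volume A + volume A :=
    (measure_mono Set.symmDiff_subset_union).trans ((measure_union_le _ _).trans_eq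
      (by rw [measure_translate_preimage]))
  calc _ ≤ (volume A + volume A).toReal := ENNReal.toReal_mono (by finiteness) h
    _ = 2 * volume.real A := by
      rw [ENNReal.toReal_add hA.ne hA.ne, two_mul]
      rfl

lemma tendsto_measureReal_translate_symmDiff {A : Set ℝ} (hA : MeasurableSet A)
    (hAfin : volume A < ⊤) :
    Tendsto (fun s : ℝ => volume.real (((fun t => t - s) ⁻¹' A) ∆ A)) (𝓝 0) (𝓝 0) := by
  let f : ℝ → C(ℝ, ℝ) := fun s => ⟨fun t => t - s, by fun_prop⟩
  have hf : Continuous f := ContinuousMap.continuous_of_continuous_uncurry f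
    (continuous_snd.sub continuous_fst)
  have hmp : ∀ s, MeasurePreserving (f s) volume volume := fun s =>
    measurePreserving_sub_right volume s
  have h := tendsto_measure_symmDiff_preimage_nhds_zero (hf.tendsto 0)
    (Eventually.of_forall hmp) (hmp 0) hA.nullMeasurableSet hAfin.ne
  have h0 : f 0 ⁻¹' A = A := by
    ext t
    simp [f]
  rw [h0] at h
  exact (ENNReal.tendsto_toReal ENNReal.zero_ne_top).comp h

lemma abs_setIntegral_translate_sub_le {A : Set ℝ} (hA : MeasurableSet A) (hAfin : volume A < ⊤)
    {φ : ℝ → ℝ} (hφ : Continuous φ) (hφ1 : ∀ t, |φ t| ≤ 1) (s : ℝ) :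
    |(∫ t in A, φ (t + s)) - ∫ t in A, φ t| ≤ volume.real (((fun t => t - s) ⁻¹' A) ∆ A) := by
  set B := (fun t => t - s) ⁻¹' A with hB
  have hBm : MeasurableSet B := (measurable_id.sub_const s) hA
  have hBfin : volume B < ⊤ := by rwa [hB, measure_translate_preimage]
  have htrans : ∫ t in A, φ (t + s) = ∫ t in B, φ t := by
    have := (measurePreserving_sub_right (volume : Measure ℝ) s).setIntegral_preimage_emb
      (MeasurableEquiv.subRight s).measurableEmbedding (fun t => φ (t + s)) A
    simpa using this.symm
  have hint : ∀ E : Set ℝ, volume E < ⊤ → IntegrableOn φ E := fun E hE =>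
    Measure.integrableOn_of_bounded hE.ne hφ.aestronglyMeasurable
      (M := 1) (Eventually.of_forall hφ1)
  have hsub : volume (B ∆ A) < ⊤ :=
    (measure_mono Set.symmDiff_subset_union).trans_lt (measure_union_lt_top hBfin hAfin)
  rw [htrans, ← integral_indicator hBm, ← integral_indicator hA,
    ← integral_sub ((hint B hBfin).integrable_indicator hBm)
      ((hint A hAfin).integrable_indicator hA), ← Real.norm_eq_abs]
  calc _ ≤ ∫ t, (B ∆ A).indicator (fun _ => (1 : ℝ)) t := by
        refine norm_integral_le_of_norm_le ((integrable_indicator_iff (hBm.symmDiff hA)).2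
          (integrableOn_const hsub.ne)) (Eventually.of_forall fun t => ?_)
        by_cases h1 : t ∈ B <;> by_cases h2 : t ∈ A <;>
          simp [Set.mem_symmDiff, h1, h2, hφ1 t]
    _ = _ := by
        rw [integral_indicator (hBm.symmDiff hA)]
        simp

/-- `L¹` distance, up to the factor `π`, between the indicator function of `A` and its Poisson
average at height `y`, bounded through the translates of `A`. -/
noncomputable def translationError (A : Set ℝ) (y : ℝ) : ℝ :=
  ∫ s : ℝ, (1 + s ^ 2)⁻¹ * volume.real (((fun t => t - y * s) ⁻¹' A) ∆ A)

lemma integrable_translationError {A : Set ℝ} (hA : MeasurableSet A) (hAfin : volume A < ⊤)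
    (y : ℝ) :
    Integrable fun s : ℝ => (1 + s ^ 2)⁻¹ * volume.real (((fun t => t - y * s) ⁻¹' A) ∆ A) := by
  refine integrable_inv_one_add_sq.mul_bdd (c := 2 * volume.real A) ?_
    (Eventually.of_forall fun s => ?_)
  · exact ((measurable_measureReal_translate_symmDiff hA).comp
      (measurable_const_mul y)).aestronglyMeasurable
  · rw [Real.norm_of_nonneg measureReal_nonneg]
    exact measureReal_translate_symmDiff_le hAfin _

lemma tendsto_translationError {A : Set ℝ} (hA : MeasurableSet A) (hAfin : volume A < ⊤) :
    Tendsto (translationError A) (𝓝[>] 0) (𝓝 0) := by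
  have h0 : ∫ s : ℝ, (1 + s ^ 2)⁻¹ * (0 : ℝ) = 0 := by simp
  rw [← h0]
  refine tendsto_integral_filter_of_dominated_convergence
    (fun s => (1 + s ^ 2)⁻¹ * (2 * volume.real A)) ?_ ?_
    (integrable_inv_one_add_sq.mul_const _) ?_
  · exact Eventually.of_forall fun y => (integrable_translationError hA hAfin y).aestronglyMeasurable
  · refine Eventually.of_forall fun y => Eventually.of_forall fun s => ?_
    rw [Real.norm_of_nonneg (by positivity)]
    gcongr
    exact measureReal_translate_symmDiff_le hAfin _
  · refine Eventually.of_forall fun s => Tendsto.const_mul _ ?_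
    refine (tendsto_measureReal_translate_symmDiff hA hAfin).comp (f := fun y : ℝ => y * s) ?_
    have : Continuous fun y : ℝ => y * s := by fun_prop
    simpa using (this.tendsto 0).mono_left nhdsWithin_le_nhds

lemma abs_setIntegral_average_sub_le {A : Set ℝ} (hA : MeasurableSet A) (hAfin : volume A < ⊤)
    {φ : ℝ → ℝ} (hφ : Continuous φ) (hφ1 : ∀ t, |φ t| ≤ 1) (y : ℝ) :
    |(∫ t in A, ∫ s : ℝ, (1 + s ^ 2)⁻¹ * φ (t + y * s)) - Real.pi * ∫ t in A, φ t| ≤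
      translationError A y := by
  have : IsFiniteMeasure (volume.restrict A) := ⟨by simpa using hAfin⟩
  have hint : Integrable (Function.uncurry fun t s : ℝ => (1 + s ^ 2)⁻¹ * φ (t + y * s))
      ((volume.restrict A).prod volume) := by
    refine (integrable_inv_one_add_sq.comp_snd (volume.restrict A)).mul_bdd (c := 1)
      (g := fun p : ℝ × ℝ => φ (p.1 + y * p.2)) ?_ (Eventually.of_forall fun p => hφ1 _)
    exact (hφ.comp (by fun_prop)).aestronglyMeasurable
  rw [integral_integral_swap hint, ← integral_univ_inv_one_add_sq, ← integral_mul_const,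
    ← integral_sub (by exact hint.integral_prod_right) (integrable_inv_one_add_sq.mul_const _),
    ← Real.norm_eq_abs]
  refine norm_integral_le_of_norm_le (integrable_translationError hA hAfin y)
    (Eventually.of_forall fun s => ?_)
  rw [integral_const_mul, ← mul_sub, norm_mul, Real.norm_of_nonneg (by positivity),
    Real.norm_eq_abs]
  gcongr
  exact abs_setIntegral_translate_sub_le hA hAfin hφ hφ1 _

lemma IsHerglotz.continuous_harmMeas_horizontal {F : ℂ → ℂ} (hF : IsHerglotz F) (S : Set ℝ)
    {y : ℝ} (hy : 0 < y) : Continuous fun t : ℝ => harmMeas (F (t + y * I)) S := by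
  have hopen : IsOpen {z : ℂ | 0 < z.im} := isOpen_lt continuous_const Complex.continuous_im
  refine continuous_iff_continuousAt.2 fun t => ?_
  have him : 0 < ((t : ℂ) + y * I).im := by simpa using hy
  have hline : ContinuousAt (fun t : ℝ => (t : ℂ) + y * I) t := by fun_prop
  have hFc : ContinuousAt F ((t : ℂ) + y * I) :=
    (hF.1.differentiableAt (hopen.mem_nhds him)).continuousAt
  exact (continuousAt_harmMeas (hF.2 _ him) S).comp
    (f := fun t : ℝ => F (t + y * I)) (ContinuousAt.comp (g := F) hFc hline)

lemma IsHerglotz.abs_harmMeas_horizontal_le_one {F : ℂ → ℂ} (hF : IsHerglotz F) (S : Set ℝ)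
    {y : ℝ} (hy : 0 < y) (t : ℝ) : |harmMeas (F (t + y * I)) S| ≤ 1 :=
  abs_harmMeas_le_one (hF.2 _ (by simpa using hy)) S

lemma IsHerglotz.abs_setIntegral_harmMeas_sub_le {F : ℂ → ℂ} (hF : IsHerglotz F) {A : Set ℝ}
    (hA : MeasurableSet A) (hAfin : volume A < ⊤) (S : Set ℝ) {ε y : ℝ} (hε : 0 < ε)
    (hy : 0 < y) :
    Real.pi * |(∫ t in A, harmMeas (F (t + ((ε + y : ℝ) : ℂ) * I)) S) -
      ∫ t in A, harmMeas (F (t + ε * I)) S| ≤ translationError A y := by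
  have h := abs_setIntegral_average_sub_le hA hAfin (hF.continuous_harmMeas_horizontal S hε)
    (hF.abs_harmMeas_horizontal_le_one S hε) y
  simp only [hF.integral_harmMeas S _ hε hy] at h
  rwa [integral_const_mul, ← mul_sub, abs_mul, abs_of_pos Real.pi_pos] at h

/-- The boundary values of harmonic measure are approximated on the line of height `y` at a rate
which depends on neither the Herglotz function nor the target set. -/
lemma IsHerglotz.abs_setIntegral_boundary_sub_le {F : ℂ → ℂ} (hF : IsHerglotz F) {A : Set ℝ}
    (hA : MeasurableSet A) (hAfin : volume A < ⊤) (S : Set ℝ) {g : ℝ → ℝ}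
    (hg : ∀ᵐ t : ℝ, Tendsto (fun y : ℝ => harmMeas (F (t + y * I)) S) (𝓝[>] 0) (𝓝 (g t)))
    {y : ℝ} (hy : 0 < y) :
    Real.pi * |(∫ t in A, harmMeas (F (t + y * I)) S) - ∫ t in A, g t| ≤
      translationError A y := by
  have : IsFiniteMeasure (volume.restrict A) := ⟨by simpa using hAfin⟩
  have hopen : IsOpen {z : ℂ | 0 < z.im} := isOpen_lt continuous_const Complex.continuous_im
  have hpos : ∀ᶠ ε : ℝ in 𝓝[>] 0, 0 < ε := self_mem_nhdsWithin
  have hmeas : ∀ {η : ℝ}, 0 < η → AEStronglyMeasurable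
      (fun t : ℝ => harmMeas (F (t + η * I)) S) (volume.restrict A) := fun hη =>
    (hF.continuous_harmMeas_horizontal S hη).aestronglyMeasurable
  have h1 : Tendsto (fun ε : ℝ => ∫ t in A, harmMeas (F (t + ε * I)) S) (𝓝[>] 0)
      (𝓝 (∫ t in A, g t)) :=
    tendsto_integral_filter_of_dominated_convergence (fun _ => 1)
      (hpos.mono fun ε hε => hmeas hε)
      (hpos.mono fun ε hε => Eventually.of_forall (hF.abs_harmMeas_horizontal_le_one S hε))
      (integrable_const 1) (ae_restrict_of_ae hg)
  have h2 : Tendsto (fun ε : ℝ => ∫ t in A, harmMeas (F (t + ((ε + y : ℝ) : ℂ) * I)) S) (𝓝[>] 0)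
      (𝓝 (∫ t in A, harmMeas (F (t + y * I)) S)) := by
    refine tendsto_integral_filter_of_dominated_convergence (fun _ => 1)
      (hpos.mono fun ε hε => hmeas (add_pos hε hy))
      (hpos.mono fun ε hε => Eventually.of_forall
        (hF.abs_harmMeas_horizontal_le_one S (add_pos hε hy)))
      (integrable_const 1) (Eventually.of_forall fun t => ?_)
    have him : 0 < ((t : ℂ) + y * I).im := by simpa using hy
    have hFc : ContinuousAt F ((t : ℂ) + y * I) :=
      (hF.1.differentiableAt (hopen.mem_nhds him)).continuousAt
    have hline : Tendsto (fun ε : ℝ => (t : ℂ) + ((ε + y : ℝ) : ℂ) * I) (𝓝[>] 0)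
        (𝓝 ((t : ℂ) + y * I)) := by
      have : Continuous fun ε : ℝ => (t : ℂ) + ((ε + y : ℝ) : ℂ) * I := by fun_prop
      simpa using (this.tendsto 0).mono_left nhdsWithin_le_nhds
    exact (continuousAt_harmMeas (hF.2 _ him) S).tendsto.comp (hFc.tendsto.comp hline)
  exact le_of_tendsto (((h2.sub h1).abs).const_mul Real.pi)
    (hpos.mono fun ε hε => hF.abs_setIntegral_harmMeas_sub_le hA hAfin S hε hy)


theorem stmt3 (F : ℕ → ℂ → ℂ) (Flim : ℂ → ℂ)
    (hF : ∀ n, IsHerglotz (F n)) (hFlim : IsHerglotz Flim)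
    (hconv : ∀ K : Set ℂ, K ⊆ {z : ℂ | 0 < z.im} → IsCompact K →
      TendstoUniformlyOn (fun n => F n) Flim atTop K)
    (A S : Set ℝ) (hA : MeasurableSet A) (hS : MeasurableSet S)
    (hAfin : MeasureTheory.volume A < ⊤)
    (g : ℕ → ℝ → ℝ) (glim : ℝ → ℝ)
    (hg : ∀ n, ∀ᵐ t : ℝ, Tendsto (fun y : ℝ => harmMeas (F n (t + y * Complex.I)) S)
      (𝓝[>] 0) (𝓝 (g n t)))
    (hglim : ∀ᵐ t : ℝ, Tendsto (fun y : ℝ => harmMeas (Flim (t + y * Complex.I)) S)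
      (𝓝[>] 0) (𝓝 (glim t))) :
    Tendsto (fun n => ∫ t in A, g n t) atTop (𝓝 (∫ t in A, glim t)) := by
  have htends : ∀ z : ℂ, 0 < z.im → Tendsto (fun n => F n z) atTop (𝓝 (Flim z)) := fun z hz =>
    (hconv {z} (by simpa using hz) isCompact_singleton).tendsto_at rfl
  have : IsFiniteMeasure (volume.restrict A) := ⟨by simpa using hAfin⟩
  have hline : ∀ y : ℝ, 0 < y → Tendsto (fun n => ∫ t in A, harmMeas (F n (t + y * I)) S) atTop
      (𝓝 (∫ t in A, harmMeas (Flim (t + y * I)) S)) := fun y hy => by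
    refine tendsto_integral_filter_of_dominated_convergence (fun _ => 1)
      (Eventually.of_forall fun n =>
        ((hF n).continuous_harmMeas_horizontal S hy).aestronglyMeasurable)
      (Eventually.of_forall fun n => Eventually.of_forall
        ((hF n).abs_harmMeas_horizontal_le_one S hy))
      (integrable_const 1) (Eventually.of_forall fun t => ?_)
    have him : 0 < ((t : ℂ) + y * I).im := by simpa using hy
    exact (continuousAt_harmMeas (hFlim.2 _ him) S).tendsto.comp (htends _ him)
  rw [Metric.tendsto_nhds]
  intro δ hδ
  have hpi : (1 : ℝ) ≤ Real.pi := by linarith [Real.pi_gt_three]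
  obtain ⟨y, hyerr, hy⟩ := (((tendsto_translationError hA hAfin).eventually_lt_const
    (show (0 : ℝ) < δ / 3 by positivity)).and self_mem_nhdsWithin).exists
  have hy : 0 < y := hy
  filter_upwards [Metric.tendsto_nhds.1 (hline y hy) (δ / 3) (by positivity)] with n hn
  have h1 := (hF n).abs_setIntegral_boundary_sub_le hA hAfin S (hg n) hy
  have h2 := hFlim.abs_setIntegral_boundary_sub_le hA hAfin S hglim hy
  have h1' := (le_mul_of_one_le_left (abs_nonneg _) hpi).trans_lt (h1.trans_lt hyerr)
  have h2' := (le_mul_of_one_le_left (abs_nonneg _) hpi).trans_lt (h2.trans_lt hyerr)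
  rw [Real.dist_eq] at hn ⊢
  rw [abs_lt] at *
  constructor <;> linarith [h1'.1, h1'.2, h2'.1, h2'.2, hn.1, hn.2]
end

section
/- Let F_n and F be Herglotz functions such that for all bounded open intervals A = (α,β) and S = (c,d) one has ∫_A ω_{F_n(t)}(S) dt → ∫_A ω_{F(t)}(S) dt as n → ∞. Then F_n → F uniformly on compact subsets of ℂ⁺. -/
open Filter Topology MeasureTheory Complex

theorem hasDerivAt_arctan_sub_div {x y : ℝ} (hy : 0 < y) (t : ℝ) :
    HasDerivAt (fun t : ℝ => Real.arctan ((t - x) / y)) (y / ((t - x) ^ 2 + y ^ 2)) t := by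
  have h := (((hasDerivAt_id t).sub_const x).div_const y).arctan
  refine h.congr_deriv ?_
  have : (t - x) ^ 2 + y ^ 2 ≠ 0 := by positivity
  have : 1 + ((t - x) / y) ^ 2 ≠ 0 := by positivity
  simp only [id]
  field_simp
  ring

theorem integrable_cauchyKernel {x y : ℝ} (hy : 0 < y) :
    Integrable (fun t : ℝ => y / ((t - x) ^ 2 + y ^ 2)) := by
  have h := ((integrable_inv_one_add_sq.comp_mul_left' (inv_ne_zero hy.ne')).const_mul
    y⁻¹).comp_sub_right x
  refine h.congr (Eventually.of_forall fun t => ?_)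
  have : (t - x) ^ 2 + y ^ 2 ≠ 0 := by positivity
  have : 1 + (y⁻¹ * (t - x)) ^ 2 ≠ 0 := by positivity
  simp only
  field_simp
  ring

/-- The Poisson kernel of the half plane as a superposition of indicators of centred intervals. -/
theorem integral_Ioi_layer {y : ℝ} (hy : 0 < y) {r : ℝ} (hr : 0 ≤ r) :
    IntegrableOn (fun ρ : ℝ => 2 * y * ρ / (ρ ^ 2 + y ^ 2) ^ 2) (Set.Ioi r) ∧
    ∫ ρ in Set.Ioi r, 2 * y * ρ / (ρ ^ 2 + y ^ 2) ^ 2 = y / (r ^ 2 + y ^ 2) := by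
  have hd : ∀ ρ ∈ Set.Ici r, HasDerivAt (fun ρ : ℝ => -(y / (ρ ^ 2 + y ^ 2)))
      (2 * y * ρ / (ρ ^ 2 + y ^ 2) ^ 2) ρ := by
    intro ρ _
    have h0 : ρ ^ 2 + y ^ 2 ≠ 0 := by positivity
    have h := ((hasDerivAt_const ρ y).div (((hasDerivAt_id ρ).pow 2).add_const (y ^ 2)) h0).neg
    refine h.congr_deriv ?_
    simp
    field_simp
  have hlim : Tendsto (fun ρ : ℝ => -(y / (ρ ^ 2 + y ^ 2))) atTop (𝓝 0) := by
    have h : Tendsto (fun ρ : ℝ => ρ ^ 2 + y ^ 2) atTop atTop :=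
      tendsto_atTop_add_const_right _ _ (tendsto_pow_atTop two_ne_zero)
    simpa using (h.const_div_atTop y).neg
  have hint := integrableOn_Ioi_deriv_of_nonneg' hd
    (fun ρ hρ => by have : 0 < ρ := lt_of_le_of_lt hr hρ
                    positivity) hlim
  refine ⟨hint, ?_⟩
  rw [integral_Ioi_of_hasDerivAt_of_tendsto' hd hint hlim]
  ring

theorem integral_cauchyKernel_mul {x y C : ℝ} (hy : 0 < y) {g : ℝ → ℝ}
    (hg : AEStronglyMeasurable g) (hC : ∀ᵐ t, ‖g t‖ ≤ C) :
    ∫ t, y / ((t - x) ^ 2 + y ^ 2) * g t =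
      ∫ ρ in Set.Ioi (0 : ℝ), 2 * y * ρ / (ρ ^ 2 + y ^ 2) ^ 2 *
        ∫ t in Set.Ioo (x - ρ) (x + ρ), g t := by
  let q : ℝ → ℝ := fun ρ => 2 * y * ρ / (ρ ^ 2 + y ^ 2) ^ 2
  let S : Set (ℝ × ℝ) := {p | |p.1 - x| < p.2}
  have hS : MeasurableSet S := measurableSet_lt (by fun_prop) (by fun_prop)
  let Φ : ℝ → ℝ → ℝ := fun t ρ => S.indicator (fun p => q p.2 * g p.1) (t, ρ)
  have hq : Measurable q := by fun_prop
  have hrow : ∀ (t : ℝ) (f : ℝ → ℝ), (∀ ρ, f ρ = (Set.Ioi |t - x|).indicator q ρ) →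
      Integrable f (volume.restrict (Set.Ioi 0)) ∧
      ∫ ρ in Set.Ioi (0:ℝ), f ρ = y / ((t - x) ^ 2 + y ^ 2) := by
    intro t f hf
    have h := integral_Ioi_layer hy (abs_nonneg (t - x))
    have hfe : f = (Set.Ioi |t - x|).indicator q := funext hf
    have hI : Set.Ioi |t - x| ∩ Set.Ioi 0 = Set.Ioi |t - x| := by
      rw [Set.Ioi_inter_Ioi]; simp
    rw [sq_abs] at h
    constructor
    · rw [hfe, integrable_indicator_iff measurableSet_Ioi, IntegrableOn,
        Measure.restrict_restrict measurableSet_Ioi, hI]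
      exact h.1
    · rw [hfe, integral_indicator measurableSet_Ioi,
        Measure.restrict_restrict measurableSet_Ioi, hI]
      exact h.2
  have hΦ : ∀ t ρ, Φ t ρ = (Set.Ioi |t - x|).indicator q ρ * g t := by
    intro t ρ
    simp only [Φ, S, Set.indicator, Set.mem_ofPred_eq, Set.mem_Ioi]
    split_ifs <;> simp
  have hmeas : AEStronglyMeasurable (Function.uncurry Φ)
      (volume.prod (volume.restrict (Set.Ioi (0:ℝ)))) := by
    refine AEStronglyMeasurable.indicator ?_ hS
    exact (hq.comp measurable_snd).aestronglyMeasurable.mul hg.comp_fst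
  have hint : Integrable (Function.uncurry Φ)
      (volume.prod (volume.restrict (Set.Ioi (0:ℝ)))) := by
    rw [integrable_prod_iff hmeas]
    constructor
    · refine Eventually.of_forall fun t => ?_
      simp only [Function.uncurry, hΦ]
      exact (hrow t _ fun _ => rfl).1.mul_const _
    · have : (fun t => ∫ ρ in Set.Ioi (0:ℝ), ‖Function.uncurry Φ (t, ρ)‖) =
          fun t => y / ((t - x) ^ 2 + y ^ 2) * ‖g t‖ := by
        funext t
        rw [← (hrow t _ fun _ => rfl).2, ← integral_mul_const]
        refine setIntegral_congr_fun measurableSet_Ioi fun ρ hρ => ?_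
        have : 0 < ρ := hρ
        simp only [Function.uncurry, hΦ, norm_mul]
        congr 1
        rw [Real.norm_eq_abs, abs_of_nonneg]
        exact Set.indicator_nonneg (fun r hr => by
          have : 0 ≤ r := (abs_nonneg _).trans (le_of_lt hr)
          simp only [q]; positivity) _
      rw [this]
      exact (integrable_cauchyKernel hy).mul_bdd (c := C) hg.norm (by simpa using hC)
  have hswap := integral_integral_swap hint
  have hleft : ∀ t, ∫ ρ in Set.Ioi (0:ℝ), Φ t ρ = y / ((t - x) ^ 2 + y ^ 2) * g t := by
    intro t
    simp only [hΦ]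
    rw [integral_mul_const, (hrow t _ fun _ => rfl).2]
  have hright : ∀ ρ, ∫ t, Φ t ρ = q ρ * ∫ t in Set.Ioo (x - ρ) (x + ρ), g t := by
    intro ρ
    rw [← integral_const_mul, ← integral_indicator measurableSet_Ioo]
    refine integral_congr_ae (Eventually.of_forall fun t => ?_)
    simp only [Φ, S, Set.indicator, Set.mem_ofPred_eq, Set.mem_Ioo]
    have : |t - x| < ρ ↔ x - ρ < t ∧ t < x + ρ := by
      rw [abs_lt]; constructor <;> rintro ⟨h1, h2⟩ <;> constructor <;> linarith
    simp only [this]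
  simp only [hleft, hright] at hswap
  exact hswap

/-- Convergence of integrals over bounded intervals of uniformly bounded functions implies
convergence of their Poisson integrals. -/
theorem tendsto_integral_cauchyKernel_mul {x y C : ℝ} (hy : 0 < y) {g : ℕ → ℝ → ℝ} {g₀ : ℝ → ℝ}
    (hg : ∀ n, AEStronglyMeasurable (g n)) (hC : ∀ n, ∀ᵐ t, ‖g n t‖ ≤ C)
    (hg₀ : AEStronglyMeasurable g₀) (hC₀ : ∀ᵐ t, ‖g₀ t‖ ≤ C)
    (h : ∀ a b : ℝ, Tendsto (fun n => ∫ t in Set.Ioo a b, g n t) atTop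
      (𝓝 (∫ t in Set.Ioo a b, g₀ t))) :
    Tendsto (fun n => ∫ t, y / ((t - x) ^ 2 + y ^ 2) * g n t) atTop
      (𝓝 (∫ t, y / ((t - x) ^ 2 + y ^ 2) * g₀ t)) := by
  simp only [fun n => integral_cauchyKernel_mul (x := x) hy (hg n) (hC n),
    integral_cauchyKernel_mul (x := x) hy hg₀ hC₀]
  refine tendsto_integral_of_dominated_convergence
    (fun ρ => 4 * C * (y / ((ρ - 0) ^ 2 + y ^ 2))) ?_ ?_ ?_ ?_
  · intro n
    refine AEStronglyMeasurable.mul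
      (by fun_prop : Measurable fun ρ : ℝ => 2 * y * ρ / (ρ ^ 2 + y ^ 2) ^ 2).aestronglyMeasurable ?_
    have hi : ∀ a b, IntervalIntegrable (g n) volume a b := fun a b => by
      rw [intervalIntegrable_iff]
      exact Measure.integrableOn_of_bounded (by simp) (hg n) (ae_restrict_of_ae (hC n))
    have hc : Continuous fun ρ : ℝ => ∫ t in (x - ρ)..(x + ρ), g n t := by
      have h1 := intervalIntegral.continuous_primitive hi 0
      have : (fun ρ : ℝ => ∫ t in (x - ρ)..(x + ρ), g n t) =
          fun ρ => (∫ t in (0:ℝ)..(x + ρ), g n t) - ∫ t in (0:ℝ)..(x - ρ), g n t := by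
        funext ρ
        rw [intervalIntegral.integral_interval_sub_left (hi _ _) (hi _ _)]
      rw [this]
      exact (h1.comp (by fun_prop : Continuous fun ρ : ℝ => x + ρ)).sub
        (h1.comp (by fun_prop : Continuous fun ρ : ℝ => x - ρ))
    refine hc.aestronglyMeasurable.congr ?_
    filter_upwards [ae_restrict_mem measurableSet_Ioi] with ρ hρ
    have : 0 < ρ := hρ
    rw [intervalIntegral.integral_of_le (by linarith), integral_Ioc_eq_integral_Ioo]
  · exact ((integrable_cauchyKernel hy).const_mul _).integrableOn
  · intro n
    filter_upwards [ae_restrict_mem measurableSet_Ioi] with ρ hρ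
    have hρ : 0 < ρ := hρ
    have hC0 : 0 ≤ C := by
      obtain ⟨t, ht⟩ := (hC n).exists
      exact (norm_nonneg _).trans ht
    have h1 : ‖∫ t in Set.Ioo (x - ρ) (x + ρ), g n t‖ ≤ C * (2 * ρ) := by
      refine (norm_setIntegral_le_of_norm_le_const_ae (C := C) (by simp) ?_).trans_eq ?_
      · exact ae_restrict_of_ae (hC n)
      · rw [Real.volume_real_Ioo_of_le (by linarith)]; ring
    rw [norm_mul, Real.norm_of_nonneg (by positivity)]
    refine (mul_le_mul_of_nonneg_left h1 (by positivity)).trans ?_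
    have : 2 * y * ρ / (ρ ^ 2 + y ^ 2) ^ 2 * (C * (2 * ρ)) =
      4 * C * (y / ((ρ - 0) ^ 2 + y ^ 2)) * (ρ ^ 2 / (ρ ^ 2 + y ^ 2)) := by
        field_simp; ring
    rw [this]
    refine mul_le_of_le_one_right (by positivity) ?_
    rw [div_le_one (by positivity)]
    nlinarith
  · exact Eventually.of_forall fun ρ => (h _ _).const_mul _

/-- The Poisson formula in the half plane for the imaginary part of a holomorphic function on a
neighbourhood of the closed half plane, with bounded imaginary part. -/
theorem im_eq_integral_cauchyKernel_mul {h : ℂ → ℂ} {C ε : ℝ} (hε : 0 < ε)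
    (hd : DifferentiableOn ℂ h {z : ℂ | 0 < z.im}) (hb : ∀ z : ℂ, 0 < z.im → ‖(h z).im‖ ≤ C)
    {x y : ℝ} (hy : 0 < y) :
    (h (x + y * I + ε * I)).im =
      (1 / Real.pi) * ∫ t : ℝ, y / ((t - x) ^ 2 + y ^ 2) * (h (t + ε * I)).im := by
  have hopen : IsOpen {z : ℂ | 0 < z.im} := isOpen_lt continuous_const continuous_im
  let φ : ℂ → ℂ := fun ζ => x + y * I * ((1 + ζ) / (1 - ζ)) + ε * I
  let f : ℂ → ℂ := fun ζ => h (φ ζ)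
  have hφim : ∀ ζ : ℂ, ‖ζ‖ ≤ 1 → 0 < (φ ζ).im := by
    intro ζ hζ
    have h2 : (φ ζ).im = y * ((1 + ζ) / (1 - ζ)).re + ε := by
      simp [φ]
    have h3 : 0 ≤ ((1 + ζ) / (1 - ζ)).re := by
      rw [div_re, ← add_div]
      refine div_nonneg ?_ (normSq_nonneg _)
      have : ζ.re * ζ.re + ζ.im * ζ.im ≤ 1 := by
        rw [← normSq_apply, normSq_eq_norm_sq]
        nlinarith [norm_nonneg ζ]
      simp
      nlinarith
    rw [h2]; positivity
  have hfd : ∀ ζ : ℂ, ‖ζ‖ ≤ 1 → ζ ≠ 1 → DifferentiableAt ℂ f ζ := by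
    intro ζ hζ h1
    have h1' : 1 - ζ ≠ 0 := sub_ne_zero.2 h1.symm
    have hφ : DifferentiableAt ℂ φ ζ := by
      simp only [φ]
      fun_prop (disch := assumption)
    exact ((hd.differentiableAt (hopen.mem_nhds (hφim ζ hζ)))).comp ζ hφ
  have hmean : ∀ r ∈ Set.Ioo (0:ℝ) 1,
      (2 * Real.pi)⁻¹ * ∫ θ in Set.Ioo 0 (2 * Real.pi), (f (circleMap 0 r θ)).im = (f 0).im := by
    intro r hr
    have hfr : ∀ ζ ∈ Metric.closedBall (0:ℂ) |r|, DifferentiableAt ℂ f ζ := by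
      intro ζ hζ
      rw [mem_closedBall_zero_iff, abs_of_pos hr.1] at hζ
      refine hfd ζ (hζ.trans hr.2.le) ?_
      rintro rfl
      simp at hζ
      linarith [hr.2]
    have h1 := circleAverage_of_differentiable_on_off_countable (s := ∅) (f := f) (c := 0) (R := r)
      Set.countable_empty (fun ζ hζ => (hfr ζ hζ).continuousAt.continuousWithinAt)
      (fun ζ hζ => hfr ζ (Metric.ball_subset_closedBall hζ.1))
    have hc : Continuous fun θ => f (circleMap 0 r θ) := by
      rw [continuous_iff_continuousAt]
      intro θ
      refine ContinuousAt.comp (g := f) (hfr _ ?_).continuousAt (continuous_circleMap 0 r).continuousAt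
      simp [abs_of_pos hr.1]
    rw [Real.circleAverage_def, intervalIntegral.integral_of_le Real.two_pi_pos.le,
      integral_Ioc_eq_integral_Ioo] at h1
    have h2 := congrArg Complex.im h1
    rw [smul_im] at h2
    rw [← h2, smul_eq_mul]
    congr 1
    have hi : IntegrableOn (fun θ => f (circleMap 0 r θ)) (Set.Ioo 0 (2 * Real.pi)) :=
      (hc.integrableOn_Icc (a := 0) (b := 2 * Real.pi)).mono_set Set.Ioo_subset_Icc_self
    exact (imCLM.integral_comp_comm hi)
  have hne1 : ∀ θ ∈ Set.Ioo 0 (2 * Real.pi), circleMap 0 1 θ ≠ 1 := by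
    intro θ hθ h1
    rw [circleMap_zero, ofReal_one, one_mul, Complex.exp_eq_one_iff] at h1
    obtain ⟨n, hn⟩ := h1
    have hn' : θ = n * (2 * Real.pi) := by
      have := congrArg Complex.im hn
      simpa using this
    rw [hn'] at hθ
    have hp := Real.two_pi_pos
    have h3 : (0:ℝ) < n := by
      by_contra hcon
      push Not at hcon
      nlinarith [hθ.1]
    have h4 : (n:ℝ) < 1 := by
      by_contra hcon
      push Not at hcon
      nlinarith [hθ.2]
    have h3' : (0:ℤ) < n := by exact_mod_cast h3
    have h4' : (n:ℤ) < 1 := by exact_mod_cast h4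
    omega
  have hlim : Tendsto (fun r : ℝ => ∫ θ in Set.Ioo 0 (2 * Real.pi), (f (circleMap 0 r θ)).im)
      (𝓝[<] 1) (𝓝 (∫ θ in Set.Ioo 0 (2 * Real.pi), (f (circleMap 0 1 θ)).im)) := by
    have hnear : ∀ᶠ r : ℝ in 𝓝[<] 1, r ∈ Set.Ioo (0:ℝ) 1 := Ioo_mem_nhdsLT one_pos
    refine tendsto_integral_filter_of_dominated_convergence (fun _ => C) ?_ ?_ ?_ ?_
    · filter_upwards [hnear] with r hr
      refine Continuous.aestronglyMeasurable ?_
      rw [continuous_iff_continuousAt]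
      intro θ
      refine continuous_im.continuousAt.comp ?_
      have hn : ‖circleMap 0 r θ‖ = r := by simp [abs_of_pos hr.1]
      refine ContinuousAt.comp (g := f) (hfd _ (hn.trans_le hr.2.le) ?_).continuousAt
        (continuous_circleMap 0 r).continuousAt
      intro h1
      rw [h1, norm_one] at hn
      linarith [hr.2]
    · filter_upwards [hnear] with r hr
      refine Eventually.of_forall fun θ => hb _ (hφim _ ?_)
      simpa [abs_of_pos hr.1] using hr.2.le
    · exact integrable_const _
    · filter_upwards [ae_restrict_mem measurableSet_Ioo] with θ hθ
      have h1 : ContinuousAt f (circleMap 0 1 θ) := (hfd _ (by simp) (hne1 θ hθ)).continuousAt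
      have h2 : ContinuousAt (fun r : ℝ => circleMap 0 r θ) 1 := by
        simp only [circleMap_zero]
        fun_prop
      have h3 : ContinuousAt (fun r : ℝ => (f (circleMap 0 r θ)).im) 1 :=
        continuous_im.continuousAt.comp (ContinuousAt.comp (g := f) h1 h2)
      exact h3.tendsto.mono_left nhdsWithin_le_nhds
  have hval : (2 * Real.pi)⁻¹ * ∫ θ in Set.Ioo 0 (2 * Real.pi), (f (circleMap 0 1 θ)).im
      = (f 0).im := by
    refine tendsto_nhds_unique (hlim.const_mul _) (tendsto_const_nhds.congr' ?_)
    filter_upwards [Ioo_mem_nhdsLT one_pos] with r hr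
    exact (hmean r hr).symm
  have hf0 : f 0 = h (x + y * I + ε * I) := by simp [f, φ]
  let τ : ℝ → ℝ := fun t => Real.pi + 2 * Real.arctan ((t - x) / y)
  have hτd : ∀ t, HasDerivAt τ (2 * (y / ((t - x) ^ 2 + y ^ 2))) t := fun t =>
    ((hasDerivAt_arctan_sub_div hy t).const_mul 2).const_add Real.pi
  have hτimg : τ '' Set.univ = Set.Ioo 0 (2 * Real.pi) := by
    ext θ
    simp only [Set.image_univ, Set.mem_range, Set.mem_Ioo, τ]
    constructor
    · rintro ⟨t, rfl⟩
      have h1 := Real.neg_pi_div_two_lt_arctan ((t - x) / y)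
      have h2 := Real.arctan_lt_pi_div_two ((t - x) / y)
      constructor <;> linarith
    · rintro ⟨h1, h2⟩
      refine ⟨x + y * Real.tan ((θ - Real.pi) / 2), ?_⟩
      rw [add_sub_cancel_left, mul_div_cancel_left₀ _ hy.ne', Real.arctan_tan] <;> linarith
  have hτinj : Set.InjOn τ Set.univ := by
    intro s _ t _ hst
    have h1 : (s - x) / y = (t - x) / y := Real.arctan_injective (by simp only [τ] at hst; linarith)
    have := (div_left_inj' hy.ne').1 h1
    linarith
  have hτf : ∀ t, f (circleMap 0 1 (τ t)) = h (t + ε * I) := by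
    intro t
    simp only [f, φ]
    congr 2
    set s : ℝ := (t - x) / y with hs
    have ht : t = x + y * s := by rw [hs]; field_simp; ring
    have hden : (1 : ℂ) - s * I ≠ 0 := by
      intro h0
      have := congrArg Complex.re h0
      simp at this
    have hc : circleMap 0 1 (τ t) = -((1 + s * I) / (1 - s * I)) := by
      have ha : Real.cos (Real.arctan s) ≠ 0 := (Real.cos_arctan_pos s).ne'
      have hts : s * Real.cos (Real.arctan s) = Real.sin (Real.arctan s) := by
        have := Real.tan_mul_cos ha
        rwa [Real.tan_arctan] at this
      have hts' : (s : ℂ) * Complex.cos (Real.arctan s) = Complex.sin (Real.arctan s) := by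
        exact_mod_cast hts
      have ha' : Complex.cos (Real.arctan s) ≠ 0 := by exact_mod_cast ha
      have he : Complex.exp (Real.arctan s * I) = Complex.cos (Real.arctan s) * (1 + s * I) := by
        rw [exp_mul_I, ← hts']; ring
      have he' : Complex.exp (-(Real.arctan s * I)) =
          Complex.cos (Real.arctan s) * (1 - s * I) := by
        rw [← neg_mul, exp_mul_I, Complex.cos_neg, Complex.sin_neg, ← hts']; ring
      have hsplit : ((τ t : ℝ) : ℂ) * I =
          Real.pi * I + (Real.arctan s * I - -(Real.arctan s * I)) := by
        simp only [τ, ← hs]; push_cast; ring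
      rw [circleMap_zero, ofReal_one, one_mul, hsplit, Complex.exp_add, Complex.exp_sub,
        exp_pi_mul_I, he, he', mul_div_mul_left _ _ ha', neg_one_mul]
    have h3 : (1 + -((1 + s * I) / (1 - s * I))) / (1 - -((1 + s * I) / (1 - s * I)))
        = -(s * I) := by
      rw [sub_neg_eq_add, ← sub_eq_add_neg]
      have e1 : (1 - (1 + s * I) / (1 - s * I)) = (-2 * (s * I)) / (1 - s * I) := by
        field_simp; ring
      have e2 : (1 + (1 + s * I) / (1 - s * I)) = 2 / (1 - s * I) := by
        field_simp; ring
      rw [e1, e2]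
      field_simp
    rw [hc, h3, ht]
    push_cast
    linear_combination (-(y * s) : ℂ) * I_sq
  have hcv := integral_image_eq_integral_abs_deriv_smul MeasurableSet.univ
    (fun t _ => (hτd t).hasDerivWithinAt) hτinj (fun θ => (f (circleMap 0 1 θ)).im)
  rw [hτimg] at hcv
  rw [← hf0, ← hval, hcv, setIntegral_univ]
  simp only [hτf, smul_eq_mul]
  have : ∀ t : ℝ, |2 * (y / ((t - x) ^ 2 + y ^ 2))| * (h (t + ε * I)).im =
      2 * (y / ((t - x) ^ 2 + y ^ 2) * (h (t + ε * I)).im) := by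
    intro t
    rw [abs_of_nonneg (by positivity)]; ring
  simp only [this]
  rw [integral_const_mul]
  field_simp

/-- The Poisson formula for vertical boundary values. -/
theorem im_eq_integral_cauchyKernel_mul_boundary {h : ℂ → ℂ} {C : ℝ} {g : ℝ → ℝ}
    (hd : DifferentiableOn ℂ h {z : ℂ | 0 < z.im}) (hb : ∀ z : ℂ, 0 < z.im → ‖(h z).im‖ ≤ C)
    (hg : ∀ᵐ t : ℝ, Tendsto (fun y : ℝ => (h (t + y * I)).im) (𝓝[>] 0) (𝓝 (g t))) :
    AEStronglyMeasurable g ∧ (∀ᵐ t, ‖g t‖ ≤ C) ∧ ∀ x y : ℝ, 0 < y →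
      (h (x + y * I)).im = (1 / Real.pi) * ∫ t : ℝ, y / ((t - x) ^ 2 + y ^ 2) * g t := by
  have hopen : IsOpen {z : ℂ | 0 < z.im} := isOpen_lt continuous_const continuous_im
  have hcont : ∀ ε : ℝ, 0 < ε → Continuous fun t : ℝ => (h (t + ε * I)).im := by
    intro ε hε
    refine continuous_im.comp (hd.continuousOn.comp_continuous (by fun_prop) fun t => ?_)
    simpa using hε
  obtain ⟨u, -, hu0, hu⟩ := exists_seq_strictAnti_tendsto' (zero_lt_one (α := ℝ))
  have hu' : Tendsto u atTop (𝓝[>] 0) :=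
    tendsto_nhdsWithin_iff.2 ⟨hu, Eventually.of_forall fun n => (hu0 n).1⟩
  have hmeas : AEStronglyMeasurable g := by
    refine aestronglyMeasurable_of_tendsto_ae atTop
      (fun n => (hcont (u n) (hu0 n).1).aestronglyMeasurable) ?_
    filter_upwards [hg] with t ht using ht.comp hu'
  have hbd : ∀ᵐ t, ‖g t‖ ≤ C := by
    filter_upwards [hg] with t ht
    refine le_of_tendsto (ht.comp hu').norm (Eventually.of_forall fun n => hb _ ?_)
    simpa using (hu0 n).1
  refine ⟨hmeas, hbd, fun x y hy => ?_⟩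
  have h1 : Tendsto (fun n => (h (x + y * I + u n * I)).im) atTop (𝓝 (h (x + y * I)).im) := by
    have hc : ContinuousAt h (x + y * I) :=
      (hd.differentiableAt (hopen.mem_nhds (by simpa using hy))).continuousAt
    have h2 : Tendsto (fun n => (x + y * I + u n * I : ℂ)) atTop (𝓝 (x + y * I)) := by
      have : Tendsto (fun n => (u n : ℂ)) atTop (𝓝 0) := by
        simpa [Function.comp_def] using (continuous_ofReal.tendsto 0).comp hu
      simpa using (this.mul_const I).const_add (x + y * I : ℂ)
    exact (continuous_im.tendsto _).comp (hc.tendsto.comp h2)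
  refine tendsto_nhds_unique h1 ?_
  simp only [fun n => im_eq_integral_cauchyKernel_mul (hu0 n).1 hd hb (x := x) hy]
  refine Tendsto.const_mul _ ?_
  refine tendsto_integral_of_dominated_convergence (fun t => y / ((t - x) ^ 2 + y ^ 2) * C)
    (fun n => ?_) ((integrable_cauchyKernel hy).mul_const _) (fun n => ?_) ?_
  · exact (integrable_cauchyKernel hy).aestronglyMeasurable.mul
      (hcont (u n) (hu0 n).1).aestronglyMeasurable
  · refine Eventually.of_forall fun t => ?_
    rw [norm_mul, Real.norm_of_nonneg (by positivity)]
    exact mul_le_mul_of_nonneg_left (hb _ (by simpa using (hu0 n).1)) (by positivity)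
  · filter_upwards [hg] with t ht
    exact (ht.comp hu').const_mul _

theorem pi_mul_harmMeas_Ioo {w : ℂ} (hw : 0 < w.im) {c d : ℝ} (hcd : c ≤ d) :
    Real.pi * harmMeas w (Set.Ioo c d) = (log (w - d) - log (w - c)).im := by
  have hs : ∀ t : ℝ, (w - t) ∈ slitPlane := fun t => Or.inr (by simpa using hw.ne')
  have hne : ∀ t : ℝ, w - t ≠ 0 := fun t => slitPlane_ne_zero (hs t)
  have hder : ∀ t ∈ Set.uIcc c d, HasDerivAt (fun t : ℝ => log (w - t)) (-1 / (w - t)) t := by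
    intro t _
    have h1 : HasDerivAt (fun t : ℝ => w - (t : ℂ)) (-1) t := by
      simpa using (hasDerivAt_id t).ofReal_comp.const_sub w
    exact h1.clog_real (hs t)
  have hc : Continuous fun t : ℝ => -1 / (w - t) :=
    Continuous.div continuous_const (by fun_prop) hne
  have h := intervalIntegral.integral_eq_sub_of_hasDerivAt hder (hc.intervalIntegrable _ _)
  rw [intervalIntegral.integral_of_le hcd, integral_Ioc_eq_integral_Ioo] at h
  have hi : IntegrableOn (fun t : ℝ => -1 / (w - t)) (Set.Ioo c d) :=
    (hc.integrableOn_Icc (a := c) (b := d)).mono_set Set.Ioo_subset_Icc_self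
  rw [← h, harmMeas, ← mul_assoc, mul_one_div_cancel Real.pi_ne_zero, one_mul]
  refine Eq.trans ?_ (imCLM.integral_comp_comm hi)
  congr 1
  funext t
  simp [div_im, normSq_apply]
  ring_nf

theorem pi_mul_harmMeas_Ioo_mem {w : ℂ} (hw : 0 < w.im) {c d : ℝ} (hcd : c ≤ d) :
    0 ≤ Real.pi * harmMeas w (Set.Ioo c d) ∧ Real.pi * harmMeas w (Set.Ioo c d) ≤ Real.pi := by
  constructor
  · rw [harmMeas]
    have : 0 ≤ ∫ t in Set.Ioo c d, w.im / ((t - w.re) ^ 2 + w.im ^ 2) :=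
      integral_nonneg fun t => by positivity
    have := Real.pi_pos
    positivity
  · rw [pi_mul_harmMeas_Ioo hw hcd, sub_im, log_im, log_im]
    have h1 := arg_le_pi (w - d)
    have h2 : 0 ≤ arg (w - c) := arg_nonneg_iff.2 (by simpa using hw.le)
    linarith

theorem cot_pi_mul_harmMeas_Ioo {w : ℂ} (hw : 0 < w.im) {c d : ℝ} (hcd : c < d) :
    Real.sin (Real.pi * harmMeas w (Set.Ioo c d)) ≠ 0 ∧
    Real.cos (Real.pi * harmMeas w (Set.Ioo c d)) / Real.sin (Real.pi * harmMeas w (Set.Ioo c d)) *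
      (d - c) = ((w.re - c) * (w.re - d) + w.im ^ 2) / w.im := by
  have hne : ∀ t : ℝ, w - t ≠ 0 := fun t h => by
    have := congrArg Complex.im h
    simp at this
    exact hw.ne' this
  rw [pi_mul_harmMeas_Ioo hw hcd.le, sub_im, log_im, log_im, Real.sin_sub, Real.cos_sub,
    cos_arg (hne d), cos_arg (hne c), sin_arg, sin_arg]
  simp only [sub_re, sub_im, ofReal_re, ofReal_im, sub_zero]
  have hC : 0 < ‖w - c‖ := norm_pos_iff.2 (hne c)
  have hD : 0 < ‖w - d‖ := norm_pos_iff.2 (hne d)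
  have hdc : d - c ≠ 0 := (sub_pos.2 hcd).ne'
  have hs : w.im / ‖w - d‖ * ((w.re - c) / ‖w - c‖) - (w.re - d) / ‖w - d‖ * (w.im / ‖w - c‖)
      = w.im * (d - c) / (‖w - d‖ * ‖w - c‖) := by
    field_simp; ring
  rw [hs]
  refine ⟨by positivity, ?_⟩
  field_simp

/-- Convergence of the harmonic measures of all intervals implies convergence of the points. -/
theorem tendsto_of_tendsto_harmMeas {w : ℕ → ℂ} {w₀ : ℂ} (hw : ∀ n, 0 < (w n).im)
    (hw₀ : 0 < w₀.im)
    (h : ∀ c d : ℝ, c < d → Tendsto (fun n => Real.pi * harmMeas (w n) (Set.Ioo c d)) atTop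
      (𝓝 (Real.pi * harmMeas w₀ (Set.Ioo c d)))) :
    Tendsto w atTop (𝓝 w₀) := by
  have hQ : ∀ c d : ℝ, c < d → Tendsto
      (fun n => (((w n).re - c) * ((w n).re - d) + (w n).im ^ 2) / (w n).im) atTop
      (𝓝 (((w₀.re - c) * (w₀.re - d) + w₀.im ^ 2) / w₀.im)) := by
    intro c d hcd
    rw [← (cot_pi_mul_harmMeas_Ioo hw₀ hcd).2]
    simp only [← fun n => (cot_pi_mul_harmMeas_Ioo (hw n) hcd).2]
    exact ((((Real.continuous_cos.tendsto _).comp (h c d hcd)).div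
      ((Real.continuous_sin.tendsto _).comp (h c d hcd))
      (cot_pi_mul_harmMeas_Ioo hw₀ hcd).1).mul_const _)
  have h1 := hQ (-1) 1 (by norm_num)
  have h2 := hQ 0 1 (by norm_num)
  have h3 := hQ (-1) 0 (by norm_num)
  have hinv : Tendsto (fun n => ((w n).im)⁻¹) atTop (𝓝 (w₀.im)⁻¹) := by
    have h4 := ((h2.add h3).div_const 2).sub h1
    refine (h4.congr fun n => ?_).trans (le_of_eq ?_)
    · have := (hw n).ne'
      field_simp; ring
    · congr 1; field_simp; ring
  have him : Tendsto (fun n => (w n).im) atTop (𝓝 w₀.im) := by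
    simpa using hinv.inv₀ (inv_ne_zero hw₀.ne')
  have hre : Tendsto (fun n => (w n).re) atTop (𝓝 w₀.re) := by
    have h4 := ((h3.sub h2).div_const 2).mul him
    refine (h4.congr fun n => ?_).trans (le_of_eq ?_)
    · have := (hw n).ne'
      field_simp; ring
    · congr 1; field_simp; ring
  have h5 := ((continuous_ofReal.tendsto _).comp hre).add
    (((continuous_ofReal.tendsto _).comp him).mul_const I)
  simpa [Function.comp_def, re_add_im] using h5

/-- A pointwise convergent sequence of Herglotz functions converges locally uniformly. -/
theorem IsHerglotz.tendstoLocallyUniformlyOn {F : ℕ → ℂ → ℂ} {F₀ : ℂ → ℂ}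
    (hF : ∀ n, IsHerglotz (F n)) (hF₀ : IsHerglotz F₀)
    (h : ∀ z : ℂ, 0 < z.im → Tendsto (fun n => F n z) atTop (𝓝 (F₀ z))) :
    TendstoLocallyUniformlyOn F F₀ atTop {z : ℂ | 0 < z.im} := by
  have hopen : IsOpen {z : ℂ | 0 < z.im} := isOpen_lt continuous_const continuous_im
  rw [hopen.tendstoLocallyUniformlyOn_iff_forall_tendsto]
  intro z hz
  have hz : 0 < z.im := hz
  obtain ⟨r, hr, hball⟩ := Metric.isOpen_iff.1 hopen z hz
  have hge : ∀ w : ℂ, 0 < w.im → 1 ≤ ‖w + I‖ := by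
    intro w hw
    refine le_trans ?_ (abs_im_le_norm _)
    simp only [add_im, I_im]
    rw [abs_of_pos (by linarith)]
    linarith
  have hne : ∀ w : ℂ, 0 < w.im → w + I ≠ 0 := fun w hw h0 => by
    have := hge w hw
    rw [h0, norm_zero] at this
    linarith
  let H : ℕ → ℂ → ℂ := fun n z => (F n z + I)⁻¹
  have hH1 : ∀ n w, 0 < w.im → ‖H n w‖ ≤ 1 := fun n w hw => by
    rw [norm_inv]
    exact inv_le_one_of_one_le₀ (hge _ ((hF n).2 w hw))
  have hHd : ∀ n, DifferentiableOn ℂ (H n) (Metric.ball z r) := fun n =>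
    (((hF n).1.mono hball).add_const I).inv fun w hw => hne _ ((hF n).2 w (hball hw))
  have hLip : ∀ n, ∀ w ∈ Metric.ball z r, dist (H n w) (H n z) ≤ 2 / r * dist w z := by
    intro n w hw
    refine dist_le_div_mul_dist_of_mapsTo_ball (hHd n) (fun v hv => ?_) hw
    rw [mem_closedBall_iff_norm]
    have := norm_sub_le (H n v) (H n z)
    linarith [hH1 n v (hball hv), hH1 n z hz]
  have hzlim : Tendsto (fun p : ℕ × ℂ => H p.1 z) (atTop ×ˢ 𝓝 z) (𝓝 (F₀ z + I)⁻¹) :=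
    (((h z hz).add_const I).inv₀ (hne _ (hF₀.2 z hz))).comp tendsto_fst
  have hdist : Tendsto (fun p : ℕ × ℂ => dist (H p.1 p.2) (H p.1 z)) (atTop ×ˢ 𝓝 z) (𝓝 0) := by
    have hb : Tendsto (fun p : ℕ × ℂ => 2 / r * dist p.2 z) (atTop ×ˢ 𝓝 z) (𝓝 0) := by
      have : Tendsto (fun w : ℂ => 2 / r * dist w z) (𝓝 z) (𝓝 (2 / r * dist z z)) :=
        (by fun_prop : Continuous fun w : ℂ => 2 / r * dist w z).tendsto z
      rw [dist_self, mul_zero] at this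
      exact this.comp tendsto_snd
    refine squeeze_zero' (Eventually.of_forall fun _ => dist_nonneg) ?_ hb
    filter_upwards [tendsto_snd.eventually (Metric.ball_mem_nhds z hr)] with p hp
    exact hLip p.1 p.2 hp
  have hHlim : Tendsto (fun p : ℕ × ℂ => H p.1 p.2) (atTop ×ˢ 𝓝 z) (𝓝 (F₀ z + I)⁻¹) := by
    rw [tendsto_iff_dist_tendsto_zero] at hzlim ⊢
    refine squeeze_zero (fun _ => dist_nonneg) (fun p => dist_triangle _ (H p.1 z) _) ?_
    simpa using hdist.add hzlim
  have hFlim : Tendsto (fun p : ℕ × ℂ => F p.1 p.2) (atTop ×ˢ 𝓝 z) (𝓝 (F₀ z)) := by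
    have := (hHlim.inv₀ (inv_ne_zero (hne _ (hF₀.2 z hz)))).sub_const I
    simpa [H] using this
  have hF₀lim : Tendsto (fun p : ℕ × ℂ => F₀ p.2) (atTop ×ˢ 𝓝 z) (𝓝 (F₀ z)) :=
    (hF₀.1.differentiableAt (hopen.mem_nhds hz)).continuousAt.tendsto.comp tendsto_snd
  exact (hF₀lim.prodMk_nhds hFlim).mono_right (nhds_le_uniformity _)

/-- Weak-star convergence of the boundary values gives convergence of harmonic measures. -/
theorem tendsto_harmMeas_of_tendsto_integral {F : ℕ → ℂ → ℂ} {F₀ : ℂ → ℂ}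
    (hF : ∀ n, IsHerglotz (F n)) (hF₀ : IsHerglotz F₀) {c d : ℝ} (hcd : c ≤ d)
    {g : ℕ → ℝ → ℝ} {g₀ : ℝ → ℝ}
    (hg : ∀ n, ∀ᵐ t : ℝ, Tendsto (fun y : ℝ => harmMeas (F n (t + y * I)) (Set.Ioo c d))
      (𝓝[>] 0) (𝓝 (g n t)))
    (hg₀ : ∀ᵐ t : ℝ, Tendsto (fun y : ℝ => harmMeas (F₀ (t + y * I)) (Set.Ioo c d))
      (𝓝[>] 0) (𝓝 (g₀ t)))
    (h : ∀ a b : ℝ, Tendsto (fun n => ∫ t in Set.Ioo a b, g n t) atTop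
      (𝓝 (∫ t in Set.Ioo a b, g₀ t)))
    {z : ℂ} (hz : 0 < z.im) :
    Tendsto (fun n => Real.pi * harmMeas (F n z) (Set.Ioo c d)) atTop
      (𝓝 (Real.pi * harmMeas (F₀ z) (Set.Ioo c d))) := by
  have key : ∀ (G : ℂ → ℂ) (γ : ℝ → ℝ), IsHerglotz G →
      (∀ᵐ t : ℝ, Tendsto (fun y : ℝ => harmMeas (G (t + y * I)) (Set.Ioo c d))
        (𝓝[>] 0) (𝓝 (γ t))) →
      AEStronglyMeasurable (fun t => Real.pi * γ t) ∧ (∀ᵐ t, ‖Real.pi * γ t‖ ≤ Real.pi) ∧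
      Real.pi * harmMeas (G z) (Set.Ioo c d) = (1 / Real.pi) *
        ∫ t : ℝ, z.im / ((t - z.re) ^ 2 + z.im ^ 2) * (Real.pi * γ t) := by
    intro G γ hG hγ
    let L : ℂ → ℂ := fun w => log (G w - d) - log (G w - c)
    have hs : ∀ (t : ℝ) (w : ℂ), 0 < w.im → G w - t ∈ slitPlane := fun t w hw =>
      Or.inr (by simpa using (hG.2 w hw).ne')
    have hLd : DifferentiableOn ℂ L {z : ℂ | 0 < z.im} :=
      ((hG.1.sub_const _).clog fun w hw => hs d w hw).sub
        ((hG.1.sub_const _).clog fun w hw => hs c w hw)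
    have hLim : ∀ w : ℂ, 0 < w.im → (L w).im = Real.pi * harmMeas (G w) (Set.Ioo c d) :=
      fun w hw => (pi_mul_harmMeas_Ioo (hG.2 w hw) hcd).symm
    have hLb : ∀ w : ℂ, 0 < w.im → ‖(L w).im‖ ≤ Real.pi := fun w hw => by
      have hmem := pi_mul_harmMeas_Ioo_mem (hG.2 w hw) hcd
      rw [hLim w hw, Real.norm_of_nonneg hmem.1]
      exact hmem.2
    have hLg : ∀ᵐ t : ℝ, Tendsto (fun y : ℝ => (L (t + y * I)).im) (𝓝[>] 0)
        (𝓝 (Real.pi * γ t)) := by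
      filter_upwards [hγ] with t ht
      refine (ht.const_mul Real.pi).congr' ?_
      filter_upwards [self_mem_nhdsWithin] with y hy
      exact (hLim _ (by simpa using hy)).symm
    obtain ⟨h1, h2, h3⟩ := im_eq_integral_cauchyKernel_mul_boundary hLd hLb hLg
    refine ⟨h1, h2, ?_⟩
    rw [← h3 z.re z.im hz, re_add_im, hLim z hz]
  rw [(key F₀ g₀ hF₀ hg₀).2.2]
  simp only [fun n => (key (F n) (g n) (hF n) (hg n)).2.2]
  refine Tendsto.const_mul _ (tendsto_integral_cauchyKernel_mul hz
    (fun n => (key (F n) (g n) (hF n) (hg n)).1) (fun n => (key (F n) (g n) (hF n) (hg n)).2.1)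
    (key F₀ g₀ hF₀ hg₀).1 (key F₀ g₀ hF₀ hg₀).2.1 fun a b => ?_)
  simp only [integral_const_mul]
  exact (h a b).const_mul _

theorem stmt4 (F : ℕ → ℂ → ℂ) (Flim : ℂ → ℂ)
    (hF : ∀ n, IsHerglotz (F n)) (hFlim : IsHerglotz Flim)
    -- boundary value functions t ↦ ω_{F_n(t)}((c,d)) and t ↦ ω_{F(t)}((c,d))
    (g : ℕ → ℝ → ℝ → ℝ → ℝ) (glim : ℝ → ℝ → ℝ → ℝ)
    (hg : ∀ n, ∀ c d : ℝ, ∀ᵐ t : ℝ,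
      Tendsto (fun y : ℝ => harmMeas (F n (t + y * Complex.I)) (Set.Ioo c d))
        (𝓝[>] 0) (𝓝 (g n c d t)))
    (hglim : ∀ c d : ℝ, ∀ᵐ t : ℝ,
      Tendsto (fun y : ℝ => harmMeas (Flim (t + y * Complex.I)) (Set.Ioo c d))
        (𝓝[>] 0) (𝓝 (glim c d t)))
    -- convergence in value distribution over bounded open intervals A = (α,β), S = (c,d)
    (hvd : ∀ α β c d : ℝ,
      Tendsto (fun n => ∫ t in Set.Ioo α β, g n c d t) atTop
        (𝓝 (∫ t in Set.Ioo α β, glim c d t))) :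
    ∀ K : Set ℂ, K ⊆ {z : ℂ | 0 < z.im} → IsCompact K →
      TendstoUniformlyOn (fun n => F n) Flim atTop K := by
  intro K hK hKc
  have hloc := IsHerglotz.tendstoLocallyUniformlyOn hF hFlim fun z hz =>
    tendsto_of_tendsto_harmMeas (fun n => (hF n).2 z hz) (hFlim.2 z hz) fun c d hcd =>
      tendsto_harmMeas_of_tendsto_integral hF hFlim hcd.le (fun n => hg n c d) (hglim c d)
        (fun a b => hvd a b c d) hz
  exact (tendstoLocallyUniformlyOn_iff_tendstoUniformlyOn_of_compact hKc).1 (hloc.mono hK)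
end

section
/- Let h_n, h : ℝ → [0,1] be Borel measurable functions such that ∫_I h_n(t) dt → ∫_I h(t) dt as n → ∞ for every bounded open interval I ⊆ ℝ. Then ∫_A h_n(t) dt → ∫_A h(t) dt for every Borel set A ⊆ ℝ of finite Lebesgue measure. -/
open Filter Topology MeasureTheory

/-- Convergence of set integrals of functions with values in `[0, 1]` passes from the members of a
countable measurable partition to a union of finite measure. -/
theorem tendsto_setIntegral_iUnion {α ι : Type*} [MeasurableSpace α] [Countable ι] {μ : Measure α}
    {f : ℕ → α → ℝ} {g : α → ℝ} (hf : ∀ n, Measurable (f n)) (hg : Measurable g)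
    (hf01 : ∀ n t, f n t ∈ Set.Icc (0 : ℝ) 1) (hg01 : ∀ t, g t ∈ Set.Icc (0 : ℝ) 1)
    {s : ι → Set α} (hs : ∀ i, MeasurableSet (s i))
    (hdisj : Pairwise (Function.onFun Disjoint s)) (hfin : μ (⋃ i, s i) ≠ ⊤)
    (hlim : ∀ i, Tendsto (fun n => ∫ t in s i, f n t ∂μ) atTop (𝓝 (∫ t in s i, g t ∂μ))) :
    Tendsto (fun n => ∫ t in ⋃ i, s i, f n t ∂μ) atTop (𝓝 (∫ t in ⋃ i, s i, g t ∂μ)) := by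
  have hint : ∀ u : α → ℝ, Measurable u → (∀ t, u t ∈ Set.Icc (0 : ℝ) 1) →
      IntegrableOn u (⋃ i, s i) μ := fun u hu hu01 =>
    Measure.integrableOn_of_bounded (M := 1) hfin hu.aestronglyMeasurable <|
      ae_of_all _ fun t => by
        rw [Real.norm_of_nonneg (hu01 t).1]
        exact (hu01 t).2
  simp_rw [fun n => integral_iUnion hs hdisj (hint _ (hf n) (hf01 n)),
    integral_iUnion hs hdisj (hint _ hg hg01)]
  refine tendsto_tsum_of_dominated_convergence (bound := fun i => μ.real (s i)) ?_ hlim ?_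
  · refine ENNReal.summable_toReal ?_
    rwa [← measure_iUnion hdisj hs]
  · refine Eventually.of_forall fun n i => ?_
    have hi : μ (s i) < ⊤ := (measure_mono (Set.subset_iUnion s i)).trans_lt hfin.lt_top
    simpa using norm_setIntegral_le_of_norm_le_const (C := 1) (f := f n) hi fun t _ => by
      rw [Real.norm_of_nonneg (hf01 n t).1]
      exact (hf01 n t).2

/-- Convergence of the integrals over all bounded open intervals implies convergence over the
traces of measurable sets on such intervals. -/
theorem tendsto_setIntegral_inter_Ioo {f : ℕ → ℝ → ℝ} {g : ℝ → ℝ}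
    (hf : ∀ n, Measurable (f n)) (hg : Measurable g)
    (hf01 : ∀ n t, f n t ∈ Set.Icc (0 : ℝ) 1) (hg01 : ∀ t, g t ∈ Set.Icc (0 : ℝ) 1)
    (hlim : ∀ a b : ℝ, Tendsto (fun n => ∫ t in Set.Ioo a b, f n t) atTop
      (𝓝 (∫ t in Set.Ioo a b, g t)))
    (a b : ℝ) {s : Set ℝ} (hs : MeasurableSet s) :
    Tendsto (fun n => ∫ t in s ∩ Set.Ioo a b, f n t) atTop
      (𝓝 (∫ t in s ∩ Set.Ioo a b, g t)) := by
  have hint : ∀ u : ℝ → ℝ, Measurable u → (∀ t, u t ∈ Set.Icc (0 : ℝ) 1) →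
      IntegrableOn u (Set.Ioo a b) := fun u hu hu01 =>
    Measure.integrableOn_of_bounded (M := 1) measure_Ioo_lt_top.ne hu.aestronglyMeasurable <|
      ae_of_all _ fun t => by
        rw [Real.norm_of_nonneg (hu01 t).1]
        exact (hu01 t).2
  induction s, hs using MeasurableSpace.induction_on_inter
    ((BorelSpace.measurable_eq (α := ℝ)).trans (borel_eq_generateFrom_Iio ℝ)) isPiSystem_Iio with
  | empty => simp
  | basic s hs =>
    obtain ⟨c, rfl⟩ := hs
    have h : Set.Iio c ∩ Set.Ioo a b = Set.Ioo a (min c b) := by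
      ext t
      simp only [Set.mem_inter_iff, Set.mem_Iio, Set.mem_Ioo, lt_min_iff]
      tauto
    simpa only [h] using hlim a (min c b)
  | compl s hs ih =>
    have h : ∀ u : ℝ → ℝ, Measurable u → (∀ t, u t ∈ Set.Icc (0 : ℝ) 1) →
        ∫ t in sᶜ ∩ Set.Ioo a b, u t =
          (∫ t in Set.Ioo a b, u t) - ∫ t in s ∩ Set.Ioo a b, u t := fun u hu hu01 => by
      rw [← integral_inter_add_sdiff hs (hint u hu hu01), Set.inter_comm s, Set.inter_comm sᶜ,
        Set.sdiff_eq, add_sub_cancel_left]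
    simp_rw [fun n => h _ (hf n) (hf01 n), h _ hg hg01]
    exact (hlim a b).sub ih
  | iUnion s hdisj hs ih =>
    simp_rw [Set.iUnion_inter]
    refine tendsto_setIntegral_iUnion hf hg hf01 hg01 (fun i => (hs i).inter measurableSet_Ioo)
      (fun i j hij => (hdisj hij).mono Set.inter_subset_left Set.inter_subset_left) ?_ ih
    rw [← Set.iUnion_inter]
    exact measure_ne_top_of_subset Set.inter_subset_right measure_Ioo_lt_top.ne

theorem stmt5 (h : ℕ → ℝ → ℝ) (hlim : ℝ → ℝ)
    (hmeas : ∀ n, Measurable (h n)) (hmeasl : Measurable hlim)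
    (hbd : ∀ n t, h n t ∈ Set.Icc (0 : ℝ) 1) (hbdl : ∀ t, hlim t ∈ Set.Icc (0 : ℝ) 1)
    (hconv : ∀ a b : ℝ, Tendsto (fun n => ∫ t in Set.Ioo a b, h n t) atTop
      (𝓝 (∫ t in Set.Ioo a b, hlim t)))
    (A : Set ℝ) (hA : MeasurableSet A) (hAfin : MeasureTheory.volume A < ⊤) :
    Tendsto (fun n => ∫ t in A, h n t) atTop (𝓝 (∫ t in A, hlim t)) := by
  have hcover : ⋃ k : ℤ, A ∩ Set.Ioc (k : ℝ) (k + 1) = A := by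
    rw [← Set.inter_iUnion, iUnion_Ioc_intCast, Set.inter_univ]
  rw [← hcover]
  refine tendsto_setIntegral_iUnion hmeas hmeasl hbd hbdl (fun k => hA.inter measurableSet_Ioc)
    (fun i j hij => (Set.pairwise_disjoint_Ioc_intCast ℝ hij).mono Set.inter_subset_right
      Set.inter_subset_right) (by rw [hcover]; exact hAfin.ne) fun k => ?_
  have hk : A ∩ Set.Ioc (k : ℝ) (k + 1) =
      A ∩ Set.Ioc (k : ℝ) (k + 1) ∩ Set.Ioo (k : ℝ) (k + 2) := by
    refine (Set.inter_eq_left.2 fun t ht => Set.mem_Ioo.2 ⟨ht.2.1, ?_⟩).symm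
    linarith [ht.2.2]
  rw [hk]
  exact tendsto_setIntegral_inter_Ioo hmeas hmeasl hbd hbdl hconv _ _ (hA.inter measurableSet_Ioc)
end
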